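/- arXiv:2109.00649 — 3 statements merged into one kernel-verified Lean document; each statement's English description precedes it below -/
import Mathlib

section
/- Let X be an integrable real-valued random variable and let N be a standard Gaussian random variable independent of X, and set Y = X + N. Then the conditional expectation E[X | Y] cannot be almost surely equal to q(Y) for any real polynomial q of degree greater than 1; i.e., if q is a real polynomial with E[X | Y] = q(Y) almost surely, then deg q ≤ 1. -/
open MeasureTheory ProbabilityTheory

open Filter Polynomial

lemma Polynomial.exists_derivative_eq {K : Type*} [Field K] [CharZero K] (q : K[X]) :
    ∃ Q : K[X], derivative Q = q := by
  induction q using Polynomial.induction_on' with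
  | add p q hp hq =>
    obtain ⟨P, rfl⟩ := hp
    obtain ⟨Q, rfl⟩ := hq
    exact ⟨P + Q, derivative_add⟩
  | monomial n a =>
    refine ⟨monomial (n + 1) (a / (n + 1)), ?_⟩
    rw [derivative_monomial]
    have : (n : K) + 1 ≠ 0 := by exact_mod_cast n.succ_ne_zero
    simp [this]

lemma Polynomial.natDegree_le_of_abs_eval_le {Q : ℝ[X]} {n : ℕ} {C : ℝ}
    (h : ∀ᶠ y in atTop, |Q.eval y| ≤ C * y ^ n) : Q.natDegree ≤ n := by
  by_contra! hn
  have hdeg : (X ^ n : ℝ[X]).degree < Q.degree := by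
    rw [degree_X_pow]
    exact lt_of_lt_of_le (by exact_mod_cast hn)
      (degree_eq_natDegree (ne_zero_of_natDegree_gt hn)).ge
  have hlim := abs_div_tendsto_atTop_atTop_of_degree_gt Q _ hdeg (monic_X_pow n).ne_zero
  obtain ⟨y, hy, hpos, hlt⟩ :=
    (h.and ((eventually_gt_atTop 0).and (hlim.eventually_gt_atTop C))).exists
  have hyn : 0 < y ^ n := pow_pos hpos n
  rw [eval_pow, eval_X, abs_div, abs_of_pos hyn, lt_div_iff₀ hyn] at hlt
  exact hlt.not_ge hy

lemma gaussianPDFReal_zero_one (t : ℝ) :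
    gaussianPDFReal 0 1 t = (√(2 * Real.pi))⁻¹ * Real.exp (-t ^ 2 / 2) := by
  simp [gaussianPDFReal]

lemma continuous_gaussianPDFReal_zero_one : Continuous (gaussianPDFReal 0 1) := by
  rw [funext gaussianPDFReal_zero_one]
  fun_prop

lemma inv_sqrt_two_mul_pi_le_one : (√(2 * Real.pi))⁻¹ ≤ 1 := by
  refine inv_le_one_of_one_le₀ ?_
  rw [Real.one_le_sqrt]
  nlinarith [Real.pi_gt_three]

lemma gaussianPDFReal_zero_one_le_one (t : ℝ) : gaussianPDFReal 0 1 t ≤ 1 := by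
  rw [gaussianPDFReal_zero_one]
  refine mul_le_one₀ inv_sqrt_two_mul_pi_le_one (Real.exp_nonneg _) ?_
  rw [Real.exp_le_one_iff]
  nlinarith [sq_nonneg t]

lemma norm_gaussianPDFReal_zero_one_le_one (t : ℝ) : ‖gaussianPDFReal 0 1 t‖ ≤ 1 := by
  rw [Real.norm_of_nonneg (gaussianPDFReal_nonneg _ _ _)]
  exact gaussianPDFReal_zero_one_le_one t

lemma hasDerivAt_gaussianPDFReal_zero_one (t : ℝ) :
    HasDerivAt (gaussianPDFReal 0 1) (-t * gaussianPDFReal 0 1 t) t := by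
  rw [funext gaussianPDFReal_zero_one]
  have h : HasDerivAt (fun t : ℝ => -t ^ 2 / 2) (-t) t := by
    convert! ((hasDerivAt_pow 2 t).neg.div_const 2) using 1
    simp only [Nat.cast_ofNat, Nat.add_one_sub_one, pow_one]
    ring
  convert! h.exp.const_mul (√(2 * Real.pi))⁻¹ using 1
  ring

lemma abs_mul_gaussianPDFReal_zero_one_le_one (t : ℝ) : |t * gaussianPDFReal 0 1 t| ≤ 1 := by
  rw [gaussianPDFReal_zero_one, abs_mul, abs_of_nonneg (a := _ * Real.exp _) (by positivity)]
  have hexp : |t| * Real.exp (-t ^ 2 / 2) ≤ 1 := by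
    have h : |t| ≤ Real.exp (t ^ 2 / 2) := by
      nlinarith [Real.add_one_le_exp (t ^ 2 / 2), sq_abs t, sq_nonneg (|t| - 1)]
    calc |t| * Real.exp (-t ^ 2 / 2) ≤ Real.exp (t ^ 2 / 2) * Real.exp (-t ^ 2 / 2) := by gcongr
      _ = 1 := by rw [← Real.exp_add]; simp [neg_div]
  calc |t| * ((√(2 * Real.pi))⁻¹ * Real.exp (-t ^ 2 / 2))
      = (√(2 * Real.pi))⁻¹ * (|t| * Real.exp (-t ^ 2 / 2)) := by ring
    _ ≤ 1 := mul_le_one₀ inv_sqrt_two_mul_pi_le_one (by positivity) hexp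

/-- The density of the convolution of `ν` with the standard Gaussian measure. -/
noncomputable def gaussianConvDensity (ν : Measure ℝ) (y : ℝ) : ℝ :=
  ∫ x, gaussianPDFReal 0 1 (y - x) ∂ν

section gaussianConvDensity

variable (ν : Measure ℝ)

lemma integrable_gaussianPDFReal_sub [IsFiniteMeasure ν] (y : ℝ) :
    Integrable (fun x => gaussianPDFReal 0 1 (y - x)) ν :=
  (integrable_const (1 : ℝ)).mono'
    (continuous_gaussianPDFReal_zero_one.comp (by fun_prop)).aestronglyMeasurable
    (ae_of_all _ fun _ => norm_gaussianPDFReal_zero_one_le_one _)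

lemma integrable_mul_gaussianPDFReal_sub {ν : Measure ℝ} (hν : Integrable id ν) (y : ℝ) :
    Integrable (fun x => x * gaussianPDFReal 0 1 (y - x)) ν := by
  have h := continuous_gaussianPDFReal_zero_one
  refine hν.norm.mono' (Continuous.aestronglyMeasurable (by fun_prop)) (ae_of_all _ fun x => ?_)
  rw [norm_mul]
  exact mul_le_of_le_one_right (norm_nonneg _) (norm_gaussianPDFReal_zero_one_le_one _)

lemma gaussianConvDensity_le_one [IsProbabilityMeasure ν] (y : ℝ) :
    gaussianConvDensity ν y ≤ 1 := by
  calc gaussianConvDensity ν y ≤ ∫ _, (1 : ℝ) ∂ν :=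
        integral_mono (integrable_gaussianPDFReal_sub ν y) (integrable_const _)
          fun _ => gaussianPDFReal_zero_one_le_one _
    _ = 1 := by simp

lemma exists_mul_gaussianPDFReal_le_gaussianConvDensity [IsProbabilityMeasure ν] :
    ∃ c > 0, ∃ M ≥ 0, ∀ y ≥ 0, c * gaussianPDFReal 0 1 (y + M) ≤ gaussianConvDensity ν y := by
  obtain ⟨n, hn⟩ : ∃ n : ℕ, ν (Metric.closedBall 0 n) ≠ 0 := by
    by_contra! h
    have := measure_iUnion_null h
    rw [Metric.iUnion_closedBall_nat] at this
    simp at this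
  refine ⟨ν.real (Metric.closedBall 0 n), ENNReal.toReal_pos hn (measure_ne_top _ _), n,
    n.cast_nonneg, fun y hy => ?_⟩
  calc ν.real (Metric.closedBall 0 n) * gaussianPDFReal 0 1 (y + n)
      = ∫ _ in Metric.closedBall 0 n, gaussianPDFReal 0 1 (y + n) ∂ν := by simp
    _ ≤ ∫ x in Metric.closedBall 0 n, gaussianPDFReal 0 1 (y - x) ∂ν := by
      refine setIntegral_mono_on (integrable_const _)
        (integrable_gaussianPDFReal_sub ν y).integrableOn measurableSet_closedBall fun x hx => ?_
      rw [mem_closedBall_zero_iff, Real.norm_eq_abs, abs_le] at hx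
      rw [gaussianPDFReal_zero_one, gaussianPDFReal_zero_one]
      have hsq : (y - x) ^ 2 ≤ (y + n) ^ 2 := sq_le_sq' (by linarith) (by linarith)
      gcongr
    _ ≤ gaussianConvDensity ν y :=
      setIntegral_le_integral (integrable_gaussianPDFReal_sub ν y)
        (ae_of_all _ fun _ => gaussianPDFReal_nonneg _ _ _)

lemma hasDerivAt_gaussianConvDensity [IsFiniteMeasure ν] (y : ℝ) :
    HasDerivAt (gaussianConvDensity ν) (∫ x, -(y - x) * gaussianPDFReal 0 1 (y - x) ∂ν) y := by
  have h := continuous_gaussianPDFReal_zero_one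
  refine (hasDerivAt_integral_of_dominated_loc_of_deriv_le (bound := fun _ => 1)
    (F' := fun y x => -(y - x) * gaussianPDFReal 0 1 (y - x)) univ_mem
    (.of_forall fun z => (integrable_gaussianPDFReal_sub ν z).aestronglyMeasurable)
    (integrable_gaussianPDFReal_sub ν y) (Continuous.aestronglyMeasurable (by fun_prop))
    (ae_of_all _ fun x z _ => ?_) (integrable_const _) (ae_of_all _ fun x z _ => ?_)).2
  · rw [neg_mul, norm_neg]
    exact abs_mul_gaussianPDFReal_zero_one_le_one _
  · exact (hasDerivAt_gaussianPDFReal_zero_one (z - x)).comp_sub_const z x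

lemma continuous_integral_mul_gaussianPDFReal_sub {ν : Measure ℝ} (hν : Integrable id ν) :
    Continuous fun y => ∫ x, x * gaussianPDFReal 0 1 (y - x) ∂ν := by
  have h := continuous_gaussianPDFReal_zero_one
  refine continuous_of_dominated (bound := fun x => ‖x‖)
    (fun y => (integrable_mul_gaussianPDFReal_sub hν y).aestronglyMeasurable)
    (fun y => ae_of_all _ fun x => ?_) hν.norm (ae_of_all _ fun x => by fun_prop)
  rw [norm_mul]
  exact mul_le_of_le_one_right (norm_nonneg _) (norm_gaussianPDFReal_zero_one_le_one _)

/-- The Tweedie formula for the density of a Gaussian convolution. -/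
lemma hasDerivAt_gaussianConvDensity_of_integrable [IsFiniteMeasure ν] (hν : Integrable id ν)
    (y : ℝ) :
    HasDerivAt (gaussianConvDensity ν)
      ((∫ x, x * gaussianPDFReal 0 1 (y - x) ∂ν) - y * gaussianConvDensity ν y) y := by
  convert! hasDerivAt_gaussianConvDensity ν y using 1
  rw [gaussianConvDensity, ← integral_const_mul, ← integral_sub
    (integrable_mul_gaussianPDFReal_sub hν y) ((integrable_gaussianPDFReal_sub ν y).const_mul y)]
  congr with x
  ring

end gaussianConvDensity

section AddGaussian

variable {Ω : Type*} [MeasurableSpace Ω] {P : Measure Ω} [IsProbabilityMeasure P] {X N : Ω → ℝ}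

lemma map_add_prodMk_eq_withDensity (hX : Measurable X) (hN : Measurable N)
    (hNlaw : P.map N = gaussianReal 0 1) (hindep : IndepFun X N P) :
    P.map (fun ω => (X ω + N ω, X ω)) =
      (volume.prod (P.map X)).withDensity fun p => gaussianPDF 0 1 (p.1 - p.2) := by
  have : IsProbabilityMeasure (P.map X) := Measure.isProbabilityMeasure_map hX.aemeasurable
  have hpdf := measurable_gaussianPDF 0 1
  refine Measure.ext_of_lintegral _ fun f hf => ?_
  calc ∫⁻ p, f p ∂P.map (fun ω => (X ω + N ω, X ω))
      = ∫⁻ p, f (p.1 + p.2, p.1) ∂P.map (fun ω => (X ω, N ω)) := by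
        rw [lintegral_map hf (by fun_prop), lintegral_map (by fun_prop) (by fun_prop)]
    _ = ∫⁻ x, (∫⁻ t, f (x + t, x) * gaussianPDF 0 1 t) ∂P.map X := by
        rw [hindep.map_prod_eq_prod_map_map hX.aemeasurable hN.aemeasurable, hNlaw,
          lintegral_prod _ (by fun_prop)]
        refine lintegral_congr fun x => ?_
        rw [gaussianReal_of_var_ne_zero _ one_ne_zero,
          lintegral_withDensity_eq_lintegral_mul _ hpdf (by fun_prop)]
        simp [mul_comm]
    _ = ∫⁻ x, (∫⁻ y, gaussianPDF 0 1 (y - x) * f (y, x)) ∂P.map X := by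
        refine lintegral_congr fun x => ?_
        rw [← lintegral_add_left_eq_self (fun y => gaussianPDF 0 1 (y - x) * f (y, x)) x]
        simp [mul_comm]
    _ = _ := by
        rw [lintegral_withDensity_eq_lintegral_mul _ (by fun_prop) hf,
          lintegral_prod_symm _ (by fun_prop)]
        rfl

lemma integral_mul_gaussianPDFReal_sub_eq_of_condExp_eq (hXm : Measurable X) (hNm : Measurable N)
    (hX : Integrable X P) (hN : P.map N = gaussianReal 0 1) (hindep : IndepFun X N P)
    {g : ℝ → ℝ} (hg : Continuous g)
    (hcond : P[X | MeasurableSpace.comap (fun ω => X ω + N ω) Real.measurableSpace]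
      =ᵐ[P] fun ω => g (X ω + N ω)) (y : ℝ) :
    ∫ x, x * gaussianPDFReal 0 1 (y - x) ∂P.map X = g y * gaussianConvDensity (P.map X) y := by
  have : IsProbabilityMeasure (P.map X) := Measure.isProbabilityMeasure_map hXm.aemeasurable
  have hid : Integrable id (P.map X) :=
    (integrable_map_measure aestronglyMeasurable_id hXm.aemeasurable).2 hX
  have hYm : Measurable fun ω => X ω + N ω := hXm.add hNm
  have hgY : Integrable (fun ω => g (X ω + N ω)) P := integrable_condExp.congr hcond
  have hlaw := map_add_prodMk_eq_withDensity hXm hNm hN hindep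
  have hpair : Measurable fun ω => (X ω + N ω, X ω) := hYm.prodMk hXm
  have hpdf : Measurable fun p : ℝ × ℝ => gaussianPDF 0 1 (p.1 - p.2) :=
    (measurable_gaussianPDF 0 1).comp (by fun_prop)
  have hJ : Integrable (fun p : ℝ × ℝ => p.2 - g p.1) (P.map fun ω => (X ω + N ω, X ω)) :=
    (integrable_map_measure (Continuous.aestronglyMeasurable (by fun_prop))
      hpair.aemeasurable).2 (hX.sub hgY)
  have hF : Integrable (fun p : ℝ × ℝ => gaussianPDFReal 0 1 (p.1 - p.2) * (p.2 - g p.1))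
      (volume.prod (P.map X)) := by
    rw [hlaw, integrable_withDensity_iff_integrable_smul' hpdf
      (ae_of_all _ fun _ => gaussianPDF_lt_top)] at hJ
    simpa only [toReal_gaussianPDF, smul_eq_mul] using hJ
  have hzero : ∀ s : Set ℝ, MeasurableSet s →
      ∫ y in s, ∫ x, gaussianPDFReal 0 1 (y - x) * (x - g y) ∂P.map X = 0 := by
    intro s hs
    calc ∫ y in s, ∫ x, gaussianPDFReal 0 1 (y - x) * (x - g y) ∂P.map X
        = ∫ p in s ×ˢ Set.univ, gaussianPDFReal 0 1 (p.1 - p.2) * (p.2 - g p.1)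
            ∂volume.prod (P.map X) := by
          rw [setIntegral_prod _ hF.integrableOn, Measure.restrict_univ]
      _ = ∫ p in s ×ˢ Set.univ, (p.2 - g p.1) ∂P.map fun ω => (X ω + N ω, X ω) := by
          rw [hlaw, setIntegral_withDensity_eq_setIntegral_toReal_smul hpdf
            (ae_of_all _ fun _ => gaussianPDF_lt_top) _ (hs.prod .univ)]
          simp only [toReal_gaussianPDF, smul_eq_mul]
      _ = ∫ ω in (fun ω => X ω + N ω) ⁻¹' s, (X ω - g (X ω + N ω)) ∂P := by
          rw [setIntegral_map (hs.prod .univ) hJ.aestronglyMeasurable hpair.aemeasurable]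
          congr 2
          ext ω
          simp
      _ = 0 := by
          rw [integral_sub hX.integrableOn hgY.integrableOn, sub_eq_zero,
            ← setIntegral_condExp hYm.comap_le hX ⟨s, hs, rfl⟩]
          exact integral_congr_ae (ae_restrict_of_ae hcond)
  have hsplit : ∀ y, ∫ x, gaussianPDFReal 0 1 (y - x) * (x - g y) ∂P.map X =
      (∫ x, x * gaussianPDFReal 0 1 (y - x) ∂P.map X) - g y * gaussianConvDensity (P.map X) y := by
    intro y
    rw [gaussianConvDensity, ← integral_const_mul, ← integral_sub
      (integrable_mul_gaussianPDFReal_sub hid y)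
      ((integrable_gaussianPDFReal_sub _ y).const_mul _)]
    congr with x
    ring
  have hae := hF.integral_prod_left.ae_eq_zero_of_forall_setIntegral_eq_zero
    fun s hs _ => hzero s hs
  have hdens : Continuous (gaussianConvDensity (P.map X)) :=
    continuous_iff_continuousAt.2 fun y => (hasDerivAt_gaussianConvDensity _ y).continuousAt
  have hcont : Continuous fun y => ∫ x, gaussianPDFReal 0 1 (y - x) * (x - g y) ∂P.map X := by
    rw [funext hsplit]
    exact (continuous_integral_mul_gaussianPDFReal_sub hid).sub (hg.mul hdens)
  have heq := congrFun ((hcont.ae_eq_iff_eq volume continuous_zero).1 hae) y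
  exact sub_eq_zero.1 ((hsplit y).symm.trans heq)

end AddGaussian

lemma exists_eq_mul_exp_of_hasDerivAt {f : ℝ → ℝ} {Q : ℝ[X]}
    (hf : ∀ y, HasDerivAt f ((Q.derivative.eval y - y) * f y) y) (y : ℝ) :
    f y = f 0 * Real.exp (Q.eval y - Q.eval 0 - y ^ 2 / 2) := by
  have hderiv : ∀ z, HasDerivAt (fun z => f z * Real.exp (z ^ 2 / 2 - Q.eval z)) 0 z := by
    intro z
    have h : HasDerivAt (fun z : ℝ => z ^ 2 / 2 - Q.eval z) (z - Q.derivative.eval z) z := by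
      convert! ((hasDerivAt_pow 2 z).div_const 2).sub (Q.hasDerivAt z) using 1
      simp
    convert! (hf z).mul h.exp using 1
    ring
  have h := is_const_of_deriv_eq_zero (fun z => (hderiv z).differentiableAt)
    (fun z => (hderiv z).deriv) y 0
  have hexp : Real.exp (Q.eval y - Q.eval 0 - y ^ 2 / 2) * Real.exp (y ^ 2 / 2 - Q.eval y)
      = Real.exp ((0 : ℝ) ^ 2 / 2 - Q.eval 0) := by
    rw [← Real.exp_add]
    congr 1
    ring
  refine mul_right_cancel₀ (Real.exp_ne_zero (y ^ 2 / 2 - Q.eval y)) ?_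
  rw [mul_assoc, hexp]
  exact h

lemma natDegree_le_two_of_gaussianConvDensity_eq {ν : Measure ℝ} [IsProbabilityMeasure ν]
    {Q : ℝ[X]} {a : ℝ}
    (h : ∀ y, gaussianConvDensity ν y = a * Real.exp (Q.eval y - y ^ 2 / 2)) :
    Q.natDegree ≤ 2 := by
  obtain ⟨c, hc, M, hM, hlow⟩ := exists_mul_gaussianPDFReal_le_gaussianConvDensity ν
  have ha : 0 < a := by
    have h0 : 0 < gaussianConvDensity ν 0 :=
      (mul_pos hc (gaussianPDFReal_pos _ _ _ one_ne_zero)).trans_le (hlow 0 le_rfl)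
    rw [h] at h0
    exact pos_of_mul_pos_left h0 (Real.exp_nonneg _)
  set b := c * (√(2 * Real.pi))⁻¹ with hb
  have hb0 : 0 < b := by positivity
  refine natDegree_le_of_abs_eval_le
    (C := |Real.log a| + |Real.log b| + M ^ 2 + M + 1) ?_
  filter_upwards [eventually_ge_atTop 1] with y hy
  have hup : Real.log a + (Q.eval y - y ^ 2 / 2) ≤ 0 := by
    have := Real.log_nonpos (by rw [h]; positivity) (gaussianConvDensity_le_one ν y)
    rwa [h, Real.log_mul ha.ne' (Real.exp_ne_zero _), Real.log_exp] at this
  have hdown : Real.log b - (y + M) ^ 2 / 2 ≤ Real.log a + (Q.eval y - y ^ 2 / 2) := by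
    have := hlow y (by linarith)
    rw [h, gaussianPDFReal_zero_one, ← mul_assoc, ← hb] at this
    have := Real.log_le_log (by positivity) this
    rw [Real.log_mul hb0.ne' (Real.exp_ne_zero _), Real.log_mul ha.ne' (Real.exp_ne_zero _),
      Real.log_exp, Real.log_exp] at this
    linarith
  have hy2 : 1 ≤ y ^ 2 := one_le_pow₀ hy
  have hyy : y ≤ y ^ 2 := by nlinarith
  have hMy : M * y ≤ M * y ^ 2 := mul_le_mul_of_nonneg_left hyy hM
  have hconst : |Real.log a| + |Real.log b| + M ^ 2 ≤
      (|Real.log a| + |Real.log b| + M ^ 2) * y ^ 2 :=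
    le_mul_of_one_le_right (by positivity) hy2
  have := neg_abs_le (Real.log a)
  have := le_abs_self (Real.log a)
  have := neg_abs_le (Real.log b)
  have := abs_nonneg (Real.log b)
  rw [abs_le]
  constructor <;> nlinarith [sq_nonneg M, mul_nonneg hM (sq_nonneg y)]

/-- If `X` is integrable, `N` is a standard Gaussian independent of `X`,
and `Y = X + N`, then the conditional expectation `E[X | Y]` cannot be (a.s. equal to)
a polynomial in `Y` of degree greater than `1`. -/
theorem condexp_polynomial_degree_le_one
    {Ω : Type*} [MeasurableSpace Ω] (P : Measure Ω) [IsProbabilityMeasure P]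
    (X N : Ω → ℝ) (hXm : Measurable X) (hNm : Measurable N)
    (hXint : Integrable X P)
    (hN : Measure.map N P = gaussianReal 0 1)
    (hindep : IndepFun X N P)
    (q : Polynomial ℝ)
    (hq : P[X | MeasurableSpace.comap (fun ω => X ω + N ω) Real.measurableSpace]
        =ᵐ[P] fun ω => q.eval (X ω + N ω)) :
    q.natDegree ≤ 1 := by
  have : IsProbabilityMeasure (P.map X) := Measure.isProbabilityMeasure_map hXm.aemeasurable
  have hid : Integrable id (P.map X) :=
    (integrable_map_measure aestronglyMeasurable_id hXm.aemeasurable).2 hXint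
  obtain ⟨Q, rfl⟩ := q.exists_derivative_eq
  have hderiv : ∀ y, HasDerivAt (gaussianConvDensity (P.map X))
      ((Q.derivative.eval y - y) * gaussianConvDensity (P.map X) y) y := by
    intro y
    rw [sub_mul, ← integral_mul_gaussianPDFReal_sub_eq_of_condExp_eq hXm hNm hXint hN hindep
      (Polynomial.continuous _) hq y]
    exact hasDerivAt_gaussianConvDensity_of_integrable _ hid y
  have hdeg : Q.natDegree ≤ 2 := by
    refine natDegree_le_two_of_gaussianConvDensity_eq (ν := P.map X)
      (a := gaussianConvDensity (P.map X) 0 * Real.exp (-Q.eval 0)) fun y => ?_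
    rw [mul_assoc, ← Real.exp_add, exists_eq_mul_exp_of_hasDerivAt hderiv y]
    congr 2
    ring
  rw [natDegree_derivative]
  omega
end

section
/- Fix an integer n ≥ 1 and a real-valued random variable X with E[X^{2n}] < ∞, and set d_n := n(n+1)/2. There exist real numbers a_0, …, a_{d_n−1} and b_0, …, b_{d_n} with a_0 = σ_X² · Π_{k=1}^n k!, a_{d_n−1} = det M_{X,n}, b_0 = Π_{k=1}^n k!, b_1 = d_n · σ_X² · Π_{k=1}^n k!, and b_{d_n} = det M_{X,n}, such that for every t ≥ 0 the denominator Σ_{j=0}^{d_n} b_j t^j is strictly positive and pmmse_n(X, t) = (Σ_{j=0}^{d_n−1} a_j t^j) / (Σ_{j=0}^{d_n} b_j t^j). -/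
open MeasureTheory ProbabilityTheory

/-- The `n`-th polynomial minimum mean-square error of estimating `X` from `Y`. -/
noncomputable def pmmse {Ω : Type*} [MeasurableSpace Ω] (P : Measure Ω)
    (X Y : Ω → ℝ) (n : ℕ) : ℝ :=
  ⨅ c : Fin (n + 1) → ℝ, ∫ ω, (X ω - ∑ j : Fin (n + 1), c j * Y ω ^ (j : ℕ)) ^ 2 ∂P

/-- `pmmse_n(X, t) = pmmse_n(X | √t·X + N)`, the PMMSE in a Gaussian channel at SNR `t`. -/
noncomputable def pmmseAt {Ω : Type*} [MeasurableSpace Ω] (P : Measure Ω)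
    (X N : Ω → ℝ) (n : ℕ) (t : ℝ) : ℝ :=
  pmmse P X (fun ω => Real.sqrt t * X ω + N ω) n

/-- The Hankel moment matrix `M_{X,n} = (E[X^{i+j}])_{0 ≤ i,j ≤ n}`. -/
noncomputable def hankelMoment {Ω : Type*} [MeasurableSpace Ω] (P : Measure Ω)
    (Y : Ω → ℝ) (n : ℕ) : Matrix (Fin (n + 1)) (Fin (n + 1)) ℝ :=
  Matrix.of fun i j => ∫ ω, Y ω ^ ((i : ℕ) + (j : ℕ)) ∂P

/-- The variance `σ_X² = E[X²] - E[X]²`. -/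
noncomputable def varRV {Ω : Type*} [MeasurableSpace Ω] (P : Measure Ω) (X : Ω → ℝ) : ℝ :=
  (∫ ω, X ω ^ 2 ∂P) - (∫ ω, X ω ∂P) ^ 2

namespace PolynomialMMSE

open Polynomial

section Algebra

variable {R : Type*} [CommRing R]

/-- The moment recursion of a Gaussian law with mean `μ` and variance `v`. -/
structure IsGaussianMoments (μ v : R) (m : ℕ → R) : Prop where
  zero : m 0 = 1
  succ (k : ℕ) : m (k + 1) = μ * m k + v * (k * m (k - 1))

/-- The Hankel matrix of a sequence. -/
def hankel {α : Type*} (m : ℕ → α) (n : ℕ) : Matrix (Fin (n + 1)) (Fin (n + 1)) α :=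
  Matrix.of fun i j => m (i + j)

/-- The linear functional on polynomials with prescribed values on monomials. -/
noncomputable def momentFunctional (m : ℕ → R) : R[X] →ₗ[R] R :=
  (basisMonomials R).constr R m

theorem momentFunctional_monomial (m : ℕ → R) (k : ℕ) (a : R) :
    momentFunctional m (monomial k a) = a * m k := by
  have h : monomial k a = a • basisMonomials R k := by
    simp [smul_monomial]
  rw [h, map_smul, momentFunctional, Module.Basis.constr_basis, smul_eq_mul]

theorem momentFunctional_mul (m : ℕ → R) (n : ℕ) (p q : R[X])
    (hp : p.natDegree < n) (hq : q.natDegree < n) :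
    momentFunctional m (p * q) =
      ∑ i : Fin n, ∑ j : Fin n, p.coeff i * q.coeff j * m (i + j) := by
  conv_lhs => rw [p.as_sum_range' n hp, q.as_sum_range' n hq]
  rw [Finset.sum_mul_sum, map_sum, Finset.sum_range]
  refine Finset.sum_congr rfl fun i _ => ?_
  rw [map_sum, Finset.sum_range]
  refine Finset.sum_congr rfl fun j _ => ?_
  rw [monomial_mul_monomial, momentFunctional_monomial]

theorem IsGaussianMoments.momentFunctional_mul_eq {μ v : R} {m : ℕ → R}
    (h : IsGaussianMoments μ v m) (p : R[X]) :
    momentFunctional m ((X - C μ) * p) = v * momentFunctional m (derivative p) := by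
  induction p using Polynomial.induction_on' with
  | add p q hp hq => rw [mul_add, map_add, hp, hq, derivative_add, map_add, mul_add]
  | monomial k a =>
    rw [sub_mul, X_mul_monomial, C_mul_monomial, map_sub, derivative_monomial]
    simp only [momentFunctional_monomial, h.succ]
    ring

/-- The monic orthogonal polynomials of a Gaussian law with mean `μ` and variance `v`. -/
noncomputable def gaussianOrthogonal (μ v : R) : ℕ → R[X]
  | 0 => 1
  | k + 1 => (X - C μ) * gaussianOrthogonal μ v k -
      C v * derivative (gaussianOrthogonal μ v k)

theorem gaussianOrthogonal_monic_natDegree [Nontrivial R] (μ v : R) (k : ℕ) :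
    (gaussianOrthogonal μ v k).Monic ∧ (gaussianOrthogonal μ v k).natDegree = k := by
  induction k with
  | zero => simp [gaussianOrthogonal]
  | succ k ih =>
    obtain ⟨hm, hd⟩ := ih
    have hm' : ((X - C μ) * gaussianOrthogonal μ v k).Monic := (monic_X_sub_C μ).mul hm
    have hd' : ((X - C μ) * gaussianOrthogonal μ v k).natDegree = k + 1 := by
      rw [(monic_X_sub_C μ).natDegree_mul hm, natDegree_X_sub_C, hd, add_comm]
    have hlt : (C v * derivative (gaussianOrthogonal μ v k)).degree <
        ((X - C μ) * gaussianOrthogonal μ v k).degree := by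
      rw [degree_eq_natDegree hm'.ne_zero, hd']
      refine (degree_le_natDegree).trans_lt ?_
      have := natDegree_C_mul_le v (derivative (gaussianOrthogonal μ v k))
      have := natDegree_derivative_le (gaussianOrthogonal μ v k)
      exact_mod_cast (by omega)
    refine ⟨hm'.sub_of_left hlt, ?_⟩
    rw [gaussianOrthogonal, natDegree_eq_of_degree_eq (degree_sub_eq_left_of_degree_lt hlt), hd']

theorem IsGaussianMoments.momentFunctional_orthogonal_mul {μ v : R} {m : ℕ → R}
    (h : IsGaussianMoments μ v m) (k : ℕ) (p : R[X]) :
    momentFunctional m (gaussianOrthogonal μ v k * p) =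
      v ^ k * momentFunctional m (derivative^[k] p) := by
  induction k generalizing p with
  | zero => simp [gaussianOrthogonal]
  | succ k ih =>
    rw [gaussianOrthogonal, sub_mul, map_sub, mul_assoc, h.momentFunctional_mul_eq,
      derivative_mul, map_add, mul_add, mul_assoc, ← smul_eq_C_mul, map_smul, smul_eq_mul,
      add_sub_cancel_left, ih, Function.iterate_succ_apply]
    ring

theorem IsGaussianMoments.momentFunctional_orthogonal_of_lt [Nontrivial R] {μ v : R}
    {m : ℕ → R} (h : IsGaussianMoments μ v m) {j k : ℕ} (hjk : j < k) :
    momentFunctional m (gaussianOrthogonal μ v k * gaussianOrthogonal μ v j) = 0 := by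
  rw [h.momentFunctional_orthogonal_mul, iterate_derivative_eq_zero, map_zero, mul_zero]
  rwa [(gaussianOrthogonal_monic_natDegree μ v j).2]

theorem IsGaussianMoments.momentFunctional_orthogonal_self [Nontrivial R] {μ v : R}
    {m : ℕ → R} (h : IsGaussianMoments μ v m) (k : ℕ) :
    momentFunctional m (gaussianOrthogonal μ v k * gaussianOrthogonal μ v k) =
      v ^ k * (k.factorial : R) := by
  obtain ⟨hm, hd⟩ := gaussianOrthogonal_monic_natDegree μ v k
  have hC : derivative^[k] (gaussianOrthogonal μ v k) = monomial 0 (k.factorial : R) := by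
    have h0 : (derivative^[k] (gaussianOrthogonal μ v k)).natDegree = 0 := by
      have := natDegree_iterate_derivative (gaussianOrthogonal μ v k) k
      omega
    rw [eq_C_of_natDegree_eq_zero h0, coeff_iterate_derivative, zero_add,
      Nat.descFactorial_self]
    have : (gaussianOrthogonal μ v k).coeff k = 1 := by
      simpa [Monic, leadingCoeff, hd] using hm
    rw [this, monomial_zero_left, nsmul_one]
  rw [h.momentFunctional_orthogonal_mul, hC, momentFunctional_monomial, h.zero, mul_one]

theorem prod_range_pow_mul_factorial (v : R) (n : ℕ) :
    ∏ k ∈ Finset.range (n + 1), v ^ k * (k.factorial : R) =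
      v ^ (n * (n + 1) / 2) * ∏ k ∈ Finset.Icc 1 n, (k.factorial : R) := by
  rw [Finset.prod_mul_distrib, Finset.prod_pow_eq_pow_sum, Finset.sum_range_id,
    Nat.add_sub_cancel, mul_comm (n + 1)]
  congr 1
  rw [Finset.prod_range_succ', Nat.factorial_zero, Nat.cast_one, mul_one, Finset.range_eq_Ico,
    Finset.prod_Ico_add' (fun k => (k.factorial : R)) 0 n 1]
  rfl

theorem IsGaussianMoments.det_hankel [Nontrivial R] {μ v : R} {m : ℕ → R}
    (h : IsGaussianMoments μ v m) (n : ℕ) :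
    (hankel m n).det = v ^ (n * (n + 1) / 2) * ∏ k ∈ Finset.Icc 1 n, (k.factorial : R) := by
  let A : Matrix (Fin (n + 1)) (Fin (n + 1)) R :=
    Matrix.of fun i j => (gaussianOrthogonal μ v j).coeff i
  have hA : A.det = 1 := Matrix.det_matrixOfPolynomials _
    (fun i => (gaussianOrthogonal_monic_natDegree μ v i).2)
    (fun i => (gaussianOrthogonal_monic_natDegree μ v i).1)
  have hD : A.transpose * hankel m n * A =
      Matrix.diagonal fun i : Fin (n + 1) => v ^ (i : ℕ) * ((i : ℕ).factorial : R) := by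
    ext i j
    have hL : (A.transpose * hankel m n * A) i j =
        momentFunctional m (gaussianOrthogonal μ v i * gaussianOrthogonal μ v j) := by
      rw [momentFunctional_mul m (n + 1)]
      · simp only [Matrix.mul_apply, Finset.sum_mul, Matrix.transpose_apply, A, hankel,
          Matrix.of_apply]
        rw [Finset.sum_comm]
        refine Finset.sum_congr rfl fun a _ => Finset.sum_congr rfl fun b _ => ?_
        ring
      · rw [(gaussianOrthogonal_monic_natDegree μ v i).2]; exact i.2
      · rw [(gaussianOrthogonal_monic_natDegree μ v j).2]; exact j.2
    rw [hL]
    rcases lt_trichotomy i j with hij | rfl | hij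
    · rw [Matrix.diagonal_apply_ne _ hij.ne, mul_comm, h.momentFunctional_orthogonal_of_lt hij]
    · rw [Matrix.diagonal_apply_eq, h.momentFunctional_orthogonal_self]
    · rw [Matrix.diagonal_apply_ne _ hij.ne', h.momentFunctional_orthogonal_of_lt hij]
  have hdet := congrArg Matrix.det hD
  rw [Matrix.det_mul, Matrix.det_mul, Matrix.det_transpose, hA, one_mul, mul_one,
    Matrix.det_diagonal] at hdet
  rw [hdet, ← prod_range_pow_mul_factorial, Finset.prod_range]

/-- The binomial convolution of two sequences: the moments of a sum of independent variables. -/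
def binomialConv (m g : ℕ → R) (k : ℕ) : R :=
  ∑ ij ∈ Finset.HasAntidiagonal.antidiagonal k, (k.choose ij.1 : R) * (m ij.1 * g ij.2)

theorem binomialConv_succ (m g : ℕ → R) (k : ℕ) :
    binomialConv m g (k + 1) =
      binomialConv (fun i => m (i + 1)) g k + binomialConv m (fun j => g (j + 1)) k := by
  rw [binomialConv, Finset.sum_antidiagonal_choose_succ_mul fun i j => m i * g j, add_comm]
  congr 1
  refine Finset.sum_congr rfl fun ij hij => ?_
  rw [Nat.choose_symm_of_eq_add (Finset.HasAntidiagonal.mem_antidiagonal.mp hij).symm]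

theorem binomialConv_natCast_mul_left (m g : ℕ → R) (k : ℕ) :
    binomialConv (fun i => (i : R) * m (i - 1)) g k = k * binomialConv m g (k - 1) := by
  cases k with
  | zero => simp [binomialConv]
  | succ k =>
    rw [binomialConv, Finset.Nat.sum_antidiagonal_succ, binomialConv, Finset.mul_sum]
    simp only [Nat.cast_zero, zero_mul, mul_zero, zero_add, Nat.add_sub_cancel]
    refine Finset.sum_congr rfl fun ij _ => ?_
    have h := congrArg (Nat.cast (R := R)) (Nat.add_one_mul_choose_eq k ij.1)
    push_cast at h ⊢
    linear_combination (-(m ij.1 * g ij.2)) * h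

theorem binomialConv_comm (m g : ℕ → R) (k : ℕ) : binomialConv m g k = binomialConv g m k := by
  rw [binomialConv, ← Finset.Nat.sum_antidiagonal_swap, binomialConv]
  refine Finset.sum_congr rfl fun ij hij => ?_
  rw [Prod.fst_swap, Prod.snd_swap,
    Nat.choose_symm_of_eq_add (Finset.HasAntidiagonal.mem_antidiagonal.mp hij).symm,
    mul_comm (m _)]

theorem binomialConv_natCast_mul_right (m g : ℕ → R) (k : ℕ) :
    binomialConv m (fun j => (j : R) * g (j - 1)) k = k * binomialConv m g (k - 1) := by
  rw [binomialConv_comm, binomialConv_natCast_mul_left, binomialConv_comm]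

theorem IsGaussianMoments.binomialConv {μ v μ' v' : R} {m g : ℕ → R}
    (hm : IsGaussianMoments μ v m) (hg : IsGaussianMoments μ' v' g) :
    IsGaussianMoments (μ + μ') (v + v') (binomialConv m g) where
  zero := by simp [PolynomialMMSE.binomialConv, hm.zero, hg.zero]
  succ k := by
    have h1 := binomialConv_natCast_mul_left m g k
    have h2 := binomialConv_natCast_mul_right m g k
    have e1 : PolynomialMMSE.binomialConv (fun i => m (i + 1)) g k =
        μ * PolynomialMMSE.binomialConv m g k +
          v * PolynomialMMSE.binomialConv (fun i => (i : R) * m (i - 1)) g k := by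
      simp only [PolynomialMMSE.binomialConv, hm.succ, Finset.mul_sum, ← Finset.sum_add_distrib]
      exact Finset.sum_congr rfl fun _ _ => by ring
    have e2 : PolynomialMMSE.binomialConv m (fun j => g (j + 1)) k =
        μ' * PolynomialMMSE.binomialConv m g k +
          v' * PolynomialMMSE.binomialConv m (fun j => (j : R) * g (j - 1)) k := by
      simp only [PolynomialMMSE.binomialConv, hg.succ, Finset.mul_sum, ← Finset.sum_add_distrib]
      exact Finset.sum_congr rfl fun _ _ => by ring
    rw [binomialConv_succ, e1, e2, h1, h2]
    ring

theorem IsGaussianMoments.pow_mul {μ v : R} {m : ℕ → R} (h : IsGaussianMoments μ v m) (s : R) :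
    IsGaussianMoments (s * μ) (s ^ 2 * v) fun k => s ^ k * m k where
  zero := by simp [h.zero]
  succ k := by
    rw [h.succ]
    cases k with
    | zero => simp; ring
    | succ k => rw [Nat.add_sub_cancel]; ring

theorem IsGaussianMoments.map {S : Type*} [CommRing S] {μ v : R} {m : ℕ → R}
    (h : IsGaussianMoments μ v m) (f : R →+* S) :
    IsGaussianMoments (f μ) (f v) fun k => f (m k) where
  zero := by simp [h.zero]
  succ k := by rw [h.succ]; simp

/-- Gaussian moments with given mean and variance. -/
def gaussianMoments (μ v : R) : ℕ → R
  | 0 => 1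
  | 1 => μ
  | k + 2 => μ * gaussianMoments μ v (k + 1) + v * ((k + 1 : ℕ) * gaussianMoments μ v k)

theorem isGaussianMoments_gaussianMoments (μ v : R) :
    IsGaussianMoments μ v (gaussianMoments μ v) where
  zero := rfl
  succ k := by
    cases k with
    | zero => simp [gaussianMoments]
    | succ k => rfl

theorem IsGaussianMoments.odd {v : R} {m : ℕ → R} (h : IsGaussianMoments 0 v m) {k : ℕ}
    (hk : Odd k) : m k = 0 := by
  obtain ⟨l, rfl⟩ := hk
  induction l with
  | zero => rw [h.succ]; simp
  | succ l ih =>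
    rw [h.succ, show 2 * (l + 1) - 1 = 2 * l + 1 by omega, ih]
    simp

end Algebra

section Determinants

theorem hankel_isSymm {α : Type*} (m : ℕ → α) (n : ℕ) : (hankel m n).IsSymm := by
  ext i j
  simp [hankel, add_comm]

variable {R : Type*} [CommRing R]

theorem natDegree_prod_le_and_coeff {ι : Type*} (s : Finset ι) (f : ι → R[X]) (d : ι → ℕ)
    (h : ∀ i ∈ s, (f i).natDegree ≤ d i) :
    (∏ i ∈ s, f i).natDegree ≤ ∑ i ∈ s, d i ∧
      (∏ i ∈ s, f i).coeff (∑ i ∈ s, d i) = ∏ i ∈ s, (f i).coeff (d i) := by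
  classical
  induction s using Finset.induction_on with
  | empty => simp
  | insert a s ha ih =>
    obtain ⟨h1, h2⟩ := ih fun i hi => h i (Finset.mem_insert_of_mem hi)
    have h3 := h a (Finset.mem_insert_self a s)
    rw [Finset.prod_insert ha, Finset.sum_insert ha, Finset.prod_insert ha]
    exact ⟨natDegree_mul_le_of_le h3 h1,
      by rw [coeff_mul_add_eq_of_natDegree_le h3 h1, h2]⟩

variable {ι : Type*} [Fintype ι] [DecidableEq ι]

theorem det_natDegree_le_and_coeff (A : Matrix ι ι R[X]) (w : ι → ℕ)
    (h : ∀ i j, (A i j).natDegree ≤ w i + w j) :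
    A.det.natDegree ≤ 2 * ∑ i, w i ∧
      A.det.coeff (2 * ∑ i, w i) = (Matrix.of fun i j => (A i j).coeff (w i + w j)).det := by
  have hw (σ : Equiv.Perm ι) : ∑ i, (w (σ i) + w i) = 2 * ∑ i, w i := by
    rw [Finset.sum_add_distrib, Equiv.sum_comp σ w, two_mul]
  have hσ (σ : Equiv.Perm ι) := natDegree_prod_le_and_coeff Finset.univ
    (fun i => A (σ i) i) (fun i => w (σ i) + w i) fun i _ => h _ _
  simp only [hw] at hσ
  rw [Matrix.det_apply, Matrix.det_apply]
  constructor
  · refine natDegree_sum_le_of_forall_le _ _ fun σ _ => ?_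
    exact (natDegree_smul_le _ _).trans (hσ σ).1
  · rw [finsetSum_coeff]
    refine Finset.sum_congr rfl fun σ _ => ?_
    rw [coeff_smul, (hσ σ).2]
    rfl

theorem det_comp_neg_X (A : Matrix ι ι R[X]) (w : ι → ℕ)
    (h : ∀ i j, (A i j).comp (-X) = (-1) ^ (w i + w j) * A i j) :
    A.det.comp (-X) = A.det := by
  have h1 : (A.map fun p => p.comp (-X)) =
      Matrix.diagonal (fun i => (-1 : R[X]) ^ w i) * A *
        Matrix.diagonal fun i => (-1 : R[X]) ^ w i := by
    ext1 i j
    rw [Matrix.mul_diagonal, Matrix.diagonal_mul, Matrix.map_apply, h]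
    ring
  have h2 : A.det.comp (-X) = (A.map fun p => p.comp (-X)).det :=
    RingHom.map_det (compRingHom (-X)) A
  rw [h2, h1, Matrix.det_mul, Matrix.det_mul, Matrix.det_diagonal, mul_right_comm,
    ← Finset.prod_mul_distrib]
  simp [← mul_pow]

theorem eval_eq_sum_coeff_even {p : ℝ[X]} (hp : p.comp (-X) = p) {d : ℕ}
    (hd : p.natDegree ≤ 2 * d) (s : ℝ) :
    p.eval s = ∑ j ∈ Finset.range (d + 1), p.coeff (2 * j) * (s ^ 2) ^ j := by
  have hodd (j : ℕ) : p.coeff (2 * j + 1) = 0 := by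
    have h := congrArg (fun q => q.coeff (2 * j + 1)) hp
    rw [show (-X : ℝ[X]) = C (-1) * X by simp] at h
    simp only [comp_C_mul_X_coeff] at h
    rw [pow_succ, pow_mul] at h
    norm_num at h
    linarith
  rw [eval_eq_sum_range' (Nat.lt_succ_of_le hd)]
  clear hd
  induction d with
  | zero => simp
  | succ d ih =>
    rw [Finset.sum_range_succ _ (d + 1), ← ih,
      show (2 * (d + 1)).succ = (2 * d).succ + 1 + 1 by omega,
      Finset.sum_range_succ, Finset.sum_range_succ, hodd, zero_mul, add_zero, ← pow_mul]
    rfl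

/-- The symmetric matrix obtained by bordering `H` with the vector `r` and the corner `a`. -/
def bordered (a : R) (r : ι → R) (H : Matrix ι ι R) : Matrix (Unit ⊕ ι) (Unit ⊕ ι) R :=
  Matrix.fromBlocks (Matrix.of fun _ _ => a) (Matrix.of fun _ j => r j)
    (Matrix.of fun i _ => r i) H

theorem det_bordered_zero (a : R) (H : Matrix ι ι R) :
    (bordered a 0 H).det = a * H.det := by
  have h : bordered a 0 H = Matrix.fromBlocks (Matrix.of fun _ _ => a) 0 0 H := by
    ext (i | i) (j | j) <;> rfl
  rw [h, Matrix.det_fromBlocks_zero₁₂]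
  simp

theorem det_bordered_sub_mulVec (a : R) (r c : ι → R) {H : Matrix ι ι R} (hH : H.IsSymm) :
    (bordered a r H).det =
      (bordered (a - 2 * (c ⬝ᵥ r) + c ⬝ᵥ H.mulVec c) (r - H.mulVec c) H).det := by
  have hc : Matrix.vecMul c H = H.mulVec c := by
    rw [← Matrix.mulVec_transpose, hH.eq]
  have h : bordered (a - 2 * (c ⬝ᵥ r) + c ⬝ᵥ H.mulVec c) (r - H.mulVec c) H =
      Matrix.fromBlocks 1 (-Matrix.of fun _ j => c j) 0 1 * bordered a r H *
        Matrix.fromBlocks 1 0 (-Matrix.of fun i _ => c i) 1 := by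
    rw [bordered, bordered, Matrix.fromBlocks_multiply, Matrix.fromBlocks_multiply]
    congr 1 <;> ext i j
    · have hs : ∑ x, ∑ i, c x * (H x i * c i) = ∑ j, ∑ i, c i * H i j * c j := by
        rw [Finset.sum_comm]
        simp only [mul_assoc]
      simp [Matrix.mul_apply, Matrix.add_mul, dotProduct, Matrix.mulVec,
        Finset.mul_sum, Finset.sum_mul, two_mul]
      rw [Finset.sum_add_distrib, hs]
      simp only [mul_comm (r _)]
      ring
    · have := congrFun hc j
      simp only [Matrix.vecMul, dotProduct] at this
      simp [Matrix.mul_apply, ← this, sub_eq_add_neg]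
    · simp [Matrix.mul_apply, Matrix.mulVec, dotProduct, sub_eq_add_neg]
    · simp
  rw [h, Matrix.det_mul, Matrix.det_mul, Matrix.det_fromBlocks_zero₂₁,
    Matrix.det_fromBlocks_zero₁₂]
  simp

theorem det_bordered_of_mulVec_eq (a : R) {r c : ι → R} {H : Matrix ι ι R} (hH : H.IsSymm)
    (h : H.mulVec c = r) : (bordered a r H).det = (a - c ⬝ᵥ r) * H.det := by
  rw [det_bordered_sub_mulVec a r c hH, h, sub_self, det_bordered_zero]
  ring

theorem det_bordered_mul (s a : R) (r : ι → R) (H : Matrix ι ι R) :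
    (bordered (s ^ 2 * a) (fun i => s * r i) H).det = s ^ 2 * (bordered a r H).det := by
  have h : bordered (s ^ 2 * a) (fun i => s * r i) H =
      Matrix.diagonal (Sum.elim (fun _ => s) fun _ => 1) * bordered a r H *
        Matrix.diagonal (Sum.elim (fun _ => s) fun _ => 1) := by
    ext (i | i) (j | j) <;> rw [Matrix.mul_diagonal, Matrix.diagonal_mul] <;>
      simp [bordered] <;> ring
  rw [h, Matrix.det_mul, Matrix.det_mul, Matrix.det_diagonal]
  simp
  ring

theorem map_det_bordered {S : Type*} [CommRing S] (f : R →+* S) (a : R) (r : ι → R)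
    (H : Matrix ι ι R) :
    f (bordered a r H).det = (bordered (f a) (fun i => f (r i)) (H.map f)).det := by
  rw [RingHom.map_det]
  congr 1
  ext (i | i) (j | j) <;> rfl

theorem map_det_hankel {S : Type*} [CommRing S] (f : R →+* S) (m : ℕ → R) (n : ℕ) :
    f (hankel m n).det = (hankel (fun k => f (m k)) n).det := by
  rw [RingHom.map_det]
  rfl

end Determinants

section Channel

/-- `E[(s X + N) ^ k]` as a polynomial in `s`, for `X` and `N` with moments `m` and `g`. -/
noncomputable def channelMoment (m g : ℕ → ℝ) (k : ℕ) : ℝ[X] :=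
  binomialConv (fun i => X ^ i * C (m i)) (fun j => C (g j)) k

theorem coeff_channelMoment (m g : ℕ → ℝ) (k l : ℕ) :
    (channelMoment m g k).coeff l = k.choose l * (m l * g (k - l)) := by
  have hterm (i j : ℕ) : (((k.choose i : ℕ) : ℝ[X]) * (X ^ i * C (m i) * C (g j))).coeff l =
      if l = i then k.choose i * (m i * g j) else 0 := by
    rw [mul_assoc, ← C_mul, ← C_eq_natCast, coeff_C_mul, coeff_mul_C, coeff_X_pow]
    split_ifs <;> simp
  rw [channelMoment, binomialConv, finsetSum_coeff]
  simp only [hterm]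
  rw [Finset.Nat.sum_antidiagonal_eq_sum_range_succ
    (fun i j => if l = i then (k.choose i : ℝ) * (m i * g j) else 0), Finset.sum_ite_eq]
  split_ifs with h
  · rfl
  · rw [Nat.choose_eq_zero_of_lt (by simpa using h)]
    simp

theorem natDegree_channelMoment_le (m g : ℕ → ℝ) (k : ℕ) :
    (channelMoment m g k).natDegree ≤ k := by
  rw [natDegree_le_iff_coeff_eq_zero]
  intro l hl
  rw [coeff_channelMoment, Nat.choose_eq_zero_of_lt hl]
  simp

theorem channelMoment_comp_neg_X (m : ℕ → ℝ) {g : ℕ → ℝ} (hg : ∀ k, Odd k → g k = 0) (k : ℕ) :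
    (channelMoment m g k).comp (-X) = (-1) ^ k * channelMoment m g k := by
  ext l
  rw [show (-X : ℝ[X]) = C (-1) * X by simp, comp_C_mul_X_coeff,
    show ((-1) ^ k : ℝ[X]) = C ((-1) ^ k) by simp, coeff_C_mul, coeff_channelMoment]
  rcases lt_or_ge k l with hl | hl
  · rw [Nat.choose_eq_zero_of_lt hl]
    simp
  · obtain ⟨j, rfl⟩ := Nat.exists_eq_add_of_le hl
    rw [Nat.add_sub_cancel_left]
    rcases Nat.even_or_odd j with hj | hj
    · rw [pow_add, hj.neg_one_pow]
      ring
    · rw [hg j hj]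
      simp

theorem channelMoment_succ (m g : ℕ → ℝ) (k : ℕ) :
    channelMoment m g (k + 1) =
      X * channelMoment (fun i => m (i + 1)) g k + channelMoment m (fun j => g (j + 1)) k := by
  rw [channelMoment, binomialConv_succ]
  congr 1
  rw [channelMoment, binomialConv, binomialConv, Finset.mul_sum]
  exact Finset.sum_congr rfl fun _ _ => by ring

theorem eval_channelMoment (m g : ℕ → ℝ) (k : ℕ) (s : ℝ) :
    (channelMoment m g k).eval s = binomialConv (fun i => s ^ i * m i) g k := by
  simp only [channelMoment, binomialConv, eval_finsetSum, eval_mul, eval_natCast, eval_pow,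
    eval_X, eval_C]

theorem eval_zero_channelMoment (m g : ℕ → ℝ) (k : ℕ) :
    (channelMoment m g k).eval 0 = m 0 * g k := by
  rw [← coeff_zero_eq_eval_zero, coeff_channelMoment]
  simp

theorem coeff_two_det_hankel_channelMoment_congr {m m' : ℕ → ℝ} (g : ℕ → ℝ)
    (h : ∀ i < 3, m i = m' i) (n : ℕ) :
    (hankel (channelMoment m g) n).det.coeff 2 = (hankel (channelMoment m' g) n).det.coeff 2 := by
  let f := Ideal.Quotient.mk (Ideal.span {(X ^ 3 : ℝ[X])})
  have hf (k : ℕ) : f (channelMoment m g k) = f (channelMoment m' g k) := by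
    rw [Ideal.Quotient.eq, Ideal.mem_span_singleton, X_pow_dvd_iff]
    intro d hd
    rw [coeff_sub, coeff_channelMoment, coeff_channelMoment, h d hd, sub_self]
  have hdet : f (hankel (channelMoment m g) n).det = f (hankel (channelMoment m' g) n).det := by
    rw [map_det_hankel, map_det_hankel]
    simp only [hf]
  rw [Ideal.Quotient.eq, Ideal.mem_span_singleton, X_pow_dvd_iff] at hdet
  have := hdet 2 (by norm_num)
  rwa [coeff_sub, sub_eq_zero] at this

theorem coeff_one_add_C_mul_X_sq_pow (v : ℝ) (d : ℕ) :
    ((1 + X ^ 2 * C v) ^ d).coeff 0 = 1 ∧ ((1 + X ^ 2 * C v) ^ d).coeff 2 = d * v := by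
  induction d with
  | zero => simp [coeff_one]
  | succ d ih =>
    have h (p : ℝ[X]) : p * (1 + X ^ 2 * C v) = p + C v * (p * X ^ 2) := by ring
    rw [pow_succ, h]
    simp only [coeff_add, coeff_C_mul, coeff_mul_X_pow', ih.1, ih.2]
    norm_num
    ring

theorem IsGaussianMoments.channelMoment {μ v : ℝ} {m g : ℕ → ℝ} (hm : IsGaussianMoments μ v m)
    (hg : IsGaussianMoments 0 1 g) :
    IsGaussianMoments (X * C μ) (1 + X ^ 2 * C v) (channelMoment m g) := by
  have h := ((hm.map (C : ℝ →+* ℝ[X])).pow_mul X).binomialConv (hg.map (C : ℝ →+* ℝ[X]))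
  rw [C_0, C_1, add_zero, add_comm] at h
  exact h

variable {m g : ℕ → ℝ} (hm : m 0 = 1) (hg : IsGaussianMoments 0 1 g)

include hm hg

theorem coeff_zero_det_hankel_channelMoment (n : ℕ) :
    (hankel (channelMoment m g) n).det.coeff 0 = ∏ k ∈ Finset.Icc 1 n, (k.factorial : ℝ) := by
  have h := map_det_hankel (evalRingHom (0 : ℝ)) (channelMoment m g) n
  simp only [coe_evalRingHom, eval_zero_channelMoment, hm, one_mul] at h
  rw [coeff_zero_eq_eval_zero, h, hg.det_hankel, one_pow, one_mul]

theorem coeff_two_det_hankel_channelMoment (n : ℕ) :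
    (hankel (channelMoment m g) n).det.coeff 2 =
      (n * (n + 1) / 2 : ℕ) * (m 2 - m 1 ^ 2) * ∏ k ∈ Finset.Icc 1 n, (k.factorial : ℝ) := by
  obtain ⟨m', hG⟩ : ∃ m', IsGaussianMoments (m 1) (m 2 - m 1 ^ 2) m' :=
    ⟨_, isGaussianMoments_gaussianMoments _ _⟩
  rw [coeff_two_det_hankel_channelMoment_congr (m' := m')]
  · have hprod : ∏ k ∈ Finset.Icc 1 n, (k.factorial : ℝ[X]) =
        C (∏ k ∈ Finset.Icc 1 n, (k.factorial : ℝ)) := by simp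
    rw [(hG.channelMoment hg).det_hankel, hprod, coeff_mul_C,
      (coeff_one_add_C_mul_X_sq_pow _ _).2]
  · intro i hi
    have h1 : m' 1 = m 1 := by rw [hG.succ]; simp [hG.zero]
    interval_cases i
    · rw [hm, hG.zero]
    · exact h1.symm
    · rw [hG.succ 1, h1]
      simp [hG.zero]
      ring

/-- The numerator of the rational function, as a polynomial in the square root of the SNR. -/
noncomputable def numerator (m g : ℕ → ℝ) (n : ℕ) : ℝ[X] :=
  (bordered (C (m 2)) (fun j : Fin (n + 1) => channelMoment (fun i => m (i + 1)) g j)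
    (hankel (channelMoment m g) n)).det

omit hm in
theorem numerator_comp_neg_X (n : ℕ) : (numerator m g n).comp (-X) = numerator m g n := by
  refine det_comp_neg_X _ (Sum.elim (fun _ => 0) fun i => (i : ℕ)) ?_
  rintro (i | i) (j | j)
  · simp [bordered]
  · simpa [bordered] using channelMoment_comp_neg_X _ (fun _ => hg.odd) j
  · simpa [bordered] using channelMoment_comp_neg_X _ (fun _ => hg.odd) i
  · exact channelMoment_comp_neg_X _ (fun _ => hg.odd) (i + j)

omit hm in
theorem det_hankel_channelMoment_comp_neg_X (n : ℕ) :
    (hankel (channelMoment m g) n).det.comp (-X) = (hankel (channelMoment m g) n).det :=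
  det_comp_neg_X _ (fun i => (i : ℕ)) fun i j =>
    channelMoment_comp_neg_X _ (fun _ => hg.odd) (i + j)

theorem coeff_zero_numerator (n : ℕ) :
    (numerator m g n).coeff 0 =
      (m 2 - m 1 ^ 2) * ∏ k ∈ Finset.Icc 1 n, (k.factorial : ℝ) := by
  have h := map_det_bordered (evalRingHom (0 : ℝ)) (C (m 2))
    (fun j : Fin (n + 1) => channelMoment (fun i => m (i + 1)) g j)
    (hankel (channelMoment m g) n)
  have hH : (hankel (channelMoment m g) n).map (evalRingHom (0 : ℝ)) = hankel g n := by
    ext i j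
    simp [hankel, eval_zero_channelMoment, hm]
  simp only [coe_evalRingHom, eval_zero_channelMoment, eval_C] at h
  rw [coeff_zero_eq_eval_zero, numerator, h]
  rw [coe_evalRingHom] at hH
  rw [hH, det_bordered_of_mulVec_eq (c := Pi.single 0 (m 1)) _ (hankel_isSymm g n),
    hg.det_hankel, one_pow, one_mul]
  · simp [hg.zero, sq]
  · ext i
    simp [hankel, mul_comm]

theorem X_sq_mul_numerator {n : ℕ} (hn : 1 ≤ n) :
    X ^ 2 * numerator m g n =
      (bordered 1 (fun j : Fin (n + 1) => -channelMoment m (fun i => g (i + 1)) j)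
        (hankel (channelMoment m g) n)).det := by
  obtain ⟨n, rfl⟩ := Nat.exists_eq_add_of_le' hn
  have h1 : g 1 = 0 := hg.odd odd_one
  have h2 : g 2 = 1 := by rw [hg.succ]; simp [hg.zero]
  have hcol : (hankel (channelMoment m g) (n + 1)).mulVec (Pi.single 1 1) =
      fun j : Fin (n + 2) => channelMoment m g (j + 1) := by
    ext1 j
    simp [hankel]
  rw [numerator, ← det_bordered_mul,
    det_bordered_sub_mulVec _ _ (Pi.single 1 1) (hankel_isSymm _ _), hcol]
  congr 2
  · have hc1 : channelMoment (fun i => m (i + 1)) g 1 = X * C (m 2) := by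
      simp [channelMoment, binomialConv, Finset.Nat.antidiagonal_succ, h1, hg.zero]
    have hq1 : channelMoment m (fun i => g (i + 1)) 1 = 1 := by
      simp [channelMoment, binomialConv, Finset.Nat.antidiagonal_succ, h1, h2, hm]
    simp only [single_dotProduct, one_mul]
    rw [Fin.val_one, hc1, channelMoment_succ, hc1, hq1]
    ring
  · ext1 j
    rw [Pi.sub_apply, channelMoment_succ]
    ring

omit hm in
theorem natDegree_det_hankel_le_and_coeff (n : ℕ) :
    (hankel (channelMoment m g) n).det.natDegree ≤ 2 * (n * (n + 1) / 2) ∧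
      (hankel (channelMoment m g) n).det.coeff (2 * (n * (n + 1) / 2)) = (hankel m n).det := by
  have h := det_natDegree_le_and_coeff (hankel (channelMoment m g) n) (fun i => (i : ℕ))
    fun i j => natDegree_channelMoment_le m g (i + j)
  rw [← Finset.sum_range (fun i => i), Finset.sum_range_id, Nat.add_sub_cancel,
    mul_comm (n + 1)] at h
  refine ⟨h.1, h.2.trans (congrArg _ ?_)⟩
  ext i j
  simp [hankel, coeff_channelMoment, hg.zero]

theorem natDegree_numerator_le_and_coeff {n : ℕ} (hn : 1 ≤ n) :
    (numerator m g n).natDegree ≤ 2 * (n * (n + 1) / 2 - 1) ∧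
      (numerator m g n).coeff (2 * (n * (n + 1) / 2 - 1)) = (hankel m n).det := by
  have h := det_natDegree_le_and_coeff
    (bordered 1 (fun j : Fin (n + 1) => -channelMoment m (fun i => g (i + 1)) j)
      (hankel (channelMoment m g) n)) (Sum.elim (fun _ => 0) fun i => (i : ℕ)) (by
    rintro (i | i) (j | j)
    · simp [bordered]
    · simpa [bordered] using natDegree_channelMoment_le m _ j
    · simpa [bordered] using natDegree_channelMoment_le m _ i
    · exact natDegree_channelMoment_le m g (i + j))
  have hlead : (Matrix.of fun i j => (bordered 1
      (fun j : Fin (n + 1) => -channelMoment m (fun i => g (i + 1)) j)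
      (hankel (channelMoment m g) n) i j).coeff
        (Sum.elim (fun _ => 0) (fun i : Fin (n + 1) => (i : ℕ)) i +
          Sum.elim (fun _ => 0) (fun i : Fin (n + 1) => (i : ℕ)) j)) =
        bordered 1 0 (hankel m n) := by
    have h1 : g 1 = 0 := hg.odd odd_one
    ext (i | i) (j | j) <;> simp [bordered, hankel, coeff_channelMoment, hg.zero, h1]
  rw [hlead, det_bordered_zero, one_mul, ← X_sq_mul_numerator hm hg hn, Fintype.sum_sum_type] at h
  simp only [Sum.elim_inl, Sum.elim_inr, Finset.sum_const_zero, zero_add] at h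
  rw [← Finset.sum_range (fun i => i), Finset.sum_range_id, Nat.add_sub_cancel,
    mul_comm (n + 1)] at h
  have hd : 1 ≤ n * (n + 1) / 2 := by
    rw [Nat.le_div_iff_mul_le two_pos]
    nlinarith
  obtain ⟨d, hd'⟩ := Nat.exists_eq_add_of_le' hd
  rw [hd', show 2 * (d + 1) = 2 * d + 2 by ring, coeff_X_pow_mul] at h
  rw [hd', Nat.add_sub_cancel]
  refine ⟨?_, h.2⟩
  rw [natDegree_le_iff_coeff_eq_zero]
  intro N hN
  rw [← coeff_X_pow_mul (numerator m g n) 2]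
  exact coeff_eq_zero_of_natDegree_lt (by omega)

end Channel

end PolynomialMMSE

namespace PolynomialMMSE

section Probability

theorem integrable_pow_gaussianReal (k : ℕ) :
    Integrable (fun x : ℝ => x ^ k) (gaussianReal 0 1) :=
  (memLp_id_gaussianReal (μ := 0) (v := 1) k).integrable_norm_pow'.mono' (by fun_prop)
    (by simp)

theorem integrable_gaussianPDFReal_mul_pow (k : ℕ) :
    Integrable (fun x : ℝ => gaussianPDFReal 0 1 x * x ^ k) := by
  have h := integrable_pow_gaussianReal k
  rw [gaussianReal_of_var_ne_zero 0 one_ne_zero, integrable_withDensity_iff_integrable_smul'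
    (measurable_gaussianPDF 0 1) (Filter.Eventually.of_forall fun _ => gaussianPDF_lt_top)] at h
  simpa [toReal_gaussianPDF] using h

theorem hasDerivAt_gaussianPDFReal (x : ℝ) :
    HasDerivAt (gaussianPDFReal 0 1) (-(gaussianPDFReal 0 1 x * x)) x := by
  rw [gaussianPDFReal_def]
  have h : HasDerivAt (fun x : ℝ => -(x - 0) ^ 2 / (2 * ((1 : NNReal) : ℝ))) (-x) x := by
    have := ((((hasDerivAt_id x).sub_const 0).pow 2).neg).div_const (2 * ((1 : NNReal) : ℝ))
    refine this.congr_deriv ?_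
    simp
    ring
  refine (h.exp.const_mul _).congr_deriv ?_
  ring

theorem isGaussianMoments_gaussianReal :
    IsGaussianMoments 0 1 fun k => ∫ x : ℝ, x ^ k ∂gaussianReal 0 1 where
  zero := by simp
  succ k := by
    simp only [integral_gaussianReal_eq_integral_smul (one_ne_zero : (1 : NNReal) ≠ 0), smul_eq_mul]
    have hderiv (x : ℝ) : HasDerivAt (fun x => gaussianPDFReal 0 1 x * x ^ k)
        (k * (gaussianPDFReal 0 1 x * x ^ (k - 1)) - gaussianPDFReal 0 1 x * x ^ (k + 1)) x := by
      refine ((hasDerivAt_gaussianPDFReal x).mul (hasDerivAt_pow k x)).congr_deriv ?_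
      ring
    have h1 := (integrable_gaussianPDFReal_mul_pow (k - 1)).const_mul (k : ℝ)
    have h2 := integrable_gaussianPDFReal_mul_pow (k + 1)
    have h := integral_eq_zero_of_hasDerivAt_of_integrable hderiv (h1.sub h2)
      (integrable_gaussianPDFReal_mul_pow k)
    rw [integral_sub h1 h2, integral_const_mul] at h
    linarith

variable {Ω : Type*} [MeasurableSpace Ω] {P : Measure Ω}

theorem integrable_pow_of_le [IsFiniteMeasure P] {X : Ω → ℝ} (hX : Measurable X) {n k : ℕ}
    (h : Integrable (fun ω => X ω ^ (2 * n)) P) (hk : k ≤ 2 * n) :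
    Integrable (fun ω => X ω ^ k) P := by
  refine ((integrable_const (1 : ℝ)).add h).mono' (by fun_prop)
    (Filter.Eventually.of_forall fun ω => ?_)
  have hpow : X ω ^ (2 * n) = |X ω| ^ (2 * n) := ((even_two_mul n).pow_abs _).symm
  simp only [Pi.add_apply, norm_pow, Real.norm_eq_abs, hpow]
  rcases le_total |X ω| 1 with h1 | h1
  · have := pow_le_one₀ (n := k) (abs_nonneg (X ω)) h1
    have := pow_nonneg (abs_nonneg (X ω)) (2 * n)
    linarith
  · have := pow_le_pow_right₀ h1 hk
    linarith

theorem channel_moment {X N : Ω → ℝ} (hX : Measurable X) (hN : Measurable N)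
    (hindep : IndepFun X N P) (s : ℝ) (e k : ℕ)
    (hXint : ∀ j ≤ k, Integrable (fun ω => X ω ^ (e + j)) P)
    (hNint : ∀ j ≤ k, Integrable (fun ω => N ω ^ j) P) :
    Integrable (fun ω => X ω ^ e * (s * X ω + N ω) ^ k) P ∧
      ∫ ω, X ω ^ e * (s * X ω + N ω) ^ k ∂P =
        binomialConv (fun i => s ^ i * ∫ ω, X ω ^ (e + i) ∂P) (fun j => ∫ ω, N ω ^ j ∂P) k := by
  have hexp (ω : Ω) : X ω ^ e * (s * X ω + N ω) ^ k =
      ∑ ij ∈ Finset.HasAntidiagonal.antidiagonal k,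
        (k.choose ij.1 * s ^ ij.1) * (X ω ^ (e + ij.1) * N ω ^ ij.2) := by
    rw [(Commute.all _ _).add_pow', Finset.mul_sum]
    refine Finset.sum_congr rfl fun ij _ => ?_
    rw [nsmul_eq_mul]
    ring
  have hind (i j : ℕ) : IndepFun (fun ω => X ω ^ i) (fun ω => N ω ^ j) P :=
    hindep.comp (measurable_id.pow_const i) (measurable_id.pow_const j)
  have hint : ∀ ij ∈ Finset.HasAntidiagonal.antidiagonal k,
      Integrable (fun ω => (k.choose ij.1 * s ^ ij.1) * (X ω ^ (e + ij.1) * N ω ^ ij.2)) P := by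
    intro ij hij
    have hij' := Finset.HasAntidiagonal.mem_antidiagonal.mp hij
    exact ((hind (e + ij.1) ij.2).integrable_mul (hXint ij.1 (by omega))
      (hNint ij.2 (by omega))).const_mul _
  simp only [hexp]
  refine ⟨integrable_finsetSum _ hint, ?_⟩
  rw [integral_finsetSum _ hint, binomialConv]
  refine Finset.sum_congr rfl fun ij _ => ?_
  rw [integral_const_mul, (hind _ _).integral_fun_mul_eq_mul_integral
    (hX.pow_const _).aestronglyMeasurable (hN.pow_const _).aestronglyMeasurable]
  ring

variable {X Y : Ω → ℝ} {n : ℕ}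

theorem integral_sub_polynomial_sq (hX : Integrable (fun ω => X ω ^ 2) P)
    (hXY : ∀ j ≤ n, Integrable (fun ω => X ω * Y ω ^ j) P)
    (hY : ∀ k ≤ 2 * n, Integrable (fun ω => Y ω ^ k) P) (c : Fin (n + 1) → ℝ) :
    Integrable (fun ω => (X ω - ∑ j : Fin (n + 1), c j * Y ω ^ (j : ℕ)) ^ 2) P ∧
    ∫ ω, (X ω - ∑ j : Fin (n + 1), c j * Y ω ^ (j : ℕ)) ^ 2 ∂P =
      ∫ ω, X ω ^ 2 ∂P - 2 * (c ⬝ᵥ fun j : Fin (n + 1) => ∫ ω, X ω * Y ω ^ (j : ℕ) ∂P) +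
        c ⬝ᵥ (hankelMoment P Y n).mulVec c := by
  have hexp (ω : Ω) : (X ω - ∑ j : Fin (n + 1), c j * Y ω ^ (j : ℕ)) ^ 2 =
      X ω ^ 2 - ∑ j : Fin (n + 1), (2 * c j) * (X ω * Y ω ^ (j : ℕ)) +
        ∑ i : Fin (n + 1), ∑ j : Fin (n + 1), (c i * c j) * Y ω ^ ((i : ℕ) + (j : ℕ)) := by
    rw [sub_sq, sq (∑ j : Fin (n + 1), c j * Y ω ^ (j : ℕ)), Finset.sum_mul_sum, Finset.mul_sum]
    congr 1
    · congr 1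
      exact Finset.sum_congr rfl fun _ _ => by ring
    · exact Finset.sum_congr rfl fun _ _ => Finset.sum_congr rfl fun _ _ => by ring
  have h1 (j : Fin (n + 1)) : Integrable (fun ω => (2 * c j) * (X ω * Y ω ^ (j : ℕ))) P :=
    (hXY j (by omega)).const_mul _
  have h2 (i j : Fin (n + 1)) :
      Integrable (fun ω => (c i * c j) * Y ω ^ ((i : ℕ) + (j : ℕ))) P :=
    (hY _ (by omega)).const_mul _
  have h3 := integrable_finsetSum Finset.univ fun j _ => h1 j
  have h4 (i : Fin (n + 1)) := integrable_finsetSum Finset.univ fun j _ => h2 i j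
  have h5 := integrable_finsetSum Finset.univ fun i _ => h4 i
  have h6 : Integrable
      (fun ω => X ω ^ 2 - ∑ j : Fin (n + 1), (2 * c j) * (X ω * Y ω ^ (j : ℕ))) P := hX.sub h3
  simp only [hexp]
  refine ⟨h6.add h5, ?_⟩
  rw [integral_add h6 h5, integral_sub hX h3, integral_finsetSum _ fun j _ => h1 j,
    integral_finsetSum _ fun i _ => h4 i]
  congr 1
  · congr 1
    rw [dotProduct, Finset.mul_sum]
    refine Finset.sum_congr rfl fun j _ => ?_
    rw [integral_const_mul]
    ring
  · rw [dotProduct]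
    refine Finset.sum_congr rfl fun i _ => ?_
    rw [integral_finsetSum _ fun j _ => h2 i j, Matrix.mulVec, dotProduct, Finset.mul_sum]
    refine Finset.sum_congr rfl fun j _ => ?_
    rw [integral_const_mul, hankelMoment, Matrix.of_apply]
    ring

theorem hankelMoment_posDef (hY : ∀ k ≤ 2 * n, Integrable (fun ω => Y ω ^ k) P)
    (hnull : ∀ S : Set ℝ, S.Finite → P (Y ⁻¹' S) = 0) (hP : P ≠ 0) :
    (hankelMoment P Y n).PosDef := by
  refine Matrix.PosDef.of_dotProduct_mulVec_pos ?_ fun c hc => ?_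
  · ext i j
    simp [hankelMoment, add_comm]
  obtain ⟨hint, heq⟩ := integral_sub_polynomial_sq (P := P) (X := fun _ => 0) (Y := Y) (n := n)
    (by simp) (by simp) hY c
  have heq' : star c ⬝ᵥ (hankelMoment P Y n).mulVec c =
      ∫ ω, (0 - ∑ j : Fin (n + 1), c j * Y ω ^ (j : ℕ)) ^ 2 ∂P := by
    rw [heq]
    simp [dotProduct]
  have hnonneg : 0 ≤ fun ω => (0 - ∑ j : Fin (n + 1), c j * Y ω ^ (j : ℕ)) ^ 2 :=
    fun ω => sq_nonneg _
  rw [heq']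
  refine lt_of_le_of_ne (integral_nonneg hnonneg) fun h0 => hP ?_
  have hae := (integral_eq_zero_iff_of_nonneg hnonneg hint).mp h0.symm
  let p : Polynomial ℝ := ∑ j : Fin (n + 1), Polynomial.monomial (j : ℕ) (c j)
  have hp : p ≠ 0 := by
    intro hp
    refine hc (funext fun i => ?_)
    have h := congrArg (fun q => q.coeff (i : ℕ)) hp
    simpa [p, Polynomial.finsetSum_coeff, Polynomial.coeff_monomial, Fin.val_inj] using h
  have hroots := hnull _ (Polynomial.finite_setOfPred_isRoot hp)
  rw [← Measure.measure_univ_eq_zero]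
  refine measure_mono_null (t := _ ∪ _) (fun ω _ => ?_) (measure_union_null hae hroots)
  by_cases h : (0 - ∑ j : Fin (n + 1), c j * Y ω ^ (j : ℕ)) ^ 2 = 0
  · right
    have h' : ∑ j : Fin (n + 1), c j * Y ω ^ (j : ℕ) = 0 := by simpa using h
    simpa [p, Polynomial.IsRoot, Polynomial.eval_finsetSum] using h'
  · exact Or.inl h

theorem det_bordered_eq_pmmse_mul_det (hX : Integrable (fun ω => X ω ^ 2) P)
    (hXY : ∀ j ≤ n, Integrable (fun ω => X ω * Y ω ^ j) P)
    (hY : ∀ k ≤ 2 * n, Integrable (fun ω => Y ω ^ k) P)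
    (hH : (hankelMoment P Y n).PosDef) :
    (bordered (∫ ω, X ω ^ 2 ∂P) (fun j : Fin (n + 1) => ∫ ω, X ω * Y ω ^ (j : ℕ) ∂P)
      (hankelMoment P Y n)).det = pmmse P X Y n * (hankelMoment P Y n).det := by
  set H := hankelMoment P Y n with hHdef
  set r : Fin (n + 1) → ℝ := fun j => ∫ ω, X ω * Y ω ^ (j : ℕ) ∂P with hr
  have hsymm : H.IsSymm := by
    ext i j
    simp [hHdef, hankelMoment, add_comm]
  obtain ⟨c₀, hc₀⟩ : ∃ c₀, H.mulVec c₀ = r :=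
    ⟨H⁻¹.mulVec r, by
      rw [Matrix.mulVec_mulVec, Matrix.mul_nonsing_inv _ hH.det_pos.ne'.isUnit, Matrix.one_mulVec]⟩
  have herr (c : Fin (n + 1) → ℝ) :
      ∫ ω, (X ω - ∑ j : Fin (n + 1), c j * Y ω ^ (j : ℕ)) ^ 2 ∂P =
        (∫ ω, X ω ^ 2 ∂P - c₀ ⬝ᵥ r) + (c - c₀) ⬝ᵥ H.mulVec (c - c₀) := by
    rw [(integral_sub_polynomial_sq hX hXY hY c).2, ← hr, ← hHdef]
    have hswap : c₀ ⬝ᵥ H.mulVec c = c ⬝ᵥ r := by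
      rw [Matrix.dotProduct_mulVec, ← Matrix.mulVec_transpose, hsymm.eq, hc₀, dotProduct_comm]
    rw [Matrix.mulVec_sub, sub_dotProduct, dotProduct_sub, dotProduct_sub, hc₀, hswap]
    ring
  have hpmmse : pmmse P X Y n = ∫ ω, X ω ^ 2 ∂P - c₀ ⬝ᵥ r := by
    rw [pmmse]
    simp only [herr]
    have hnn (c : Fin (n + 1) → ℝ) : ∫ ω, X ω ^ 2 ∂P - c₀ ⬝ᵥ r ≤
        ∫ ω, X ω ^ 2 ∂P - c₀ ⬝ᵥ r + (c - c₀) ⬝ᵥ H.mulVec (c - c₀) :=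
      le_add_of_nonneg_right (by simpa using hH.posSemidef.dotProduct_mulVec_nonneg (c - c₀))
    refine le_antisymm ?_ (le_ciInf hnn)
    refine (ciInf_le ⟨_, Set.forall_mem_range.mpr hnn⟩ c₀).trans ?_
    simp
  rw [det_bordered_of_mulVec_eq _ hsymm hc₀, hpmmse]

theorem measure_preimage_add_gaussian_eq_zero [IsFiniteMeasure P] {X N : Ω → ℝ}
    (hX : Measurable X) (hN : Measurable N) (hindep : IndepFun X N P)
    (hlaw : Measure.map N P = gaussianReal 0 1) (s : ℝ) {S : Set ℝ} (hS : S.Finite) :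
    P ((fun ω => s * X ω + N ω) ⁻¹' S) = 0 := by
  have : NullSingletonClass (gaussianReal 0 1) := nullSingletonClass_gaussianReal one_ne_zero
  have hmeas : MeasurableSet ((fun z : ℝ × ℝ => s * z.1 + z.2) ⁻¹' S) :=
    (by fun_prop : Measurable fun z : ℝ × ℝ => s * z.1 + z.2) hS.measurableSet
  have hprod := (indepFun_iff_map_prod_eq_prod_map_map hX.aemeasurable hN.aemeasurable).mp hindep
  have h : P ((fun ω => s * X ω + N ω) ⁻¹' S) =
      Measure.map (fun ω => (X ω, N ω)) P ((fun z : ℝ × ℝ => s * z.1 + z.2) ⁻¹' S) :=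
    (Measure.map_apply (hX.prodMk hN) hmeas).symm
  rw [h, hprod, hlaw, Measure.measure_prod_null hmeas]
  refine Filter.Eventually.of_forall fun x => ?_
  exact (hS.preimage fun a _ b _ hab => by simpa using hab).measure_zero _

end Probability

end PolynomialMMSE

open PolynomialMMSE in
/-- For `n ≥ 1` and `E[X^{2n}] < ∞`, the map `t ↦ pmmse_n(X, t)` is a rational
function: with `d_n = n(n+1)/2`, there are coefficients `a_0, …, a_{d_n-1}` and
`b_0, …, b_{d_n}` with `a_0 = σ_X² ∏_{k=1}^n k!`, `a_{d_n-1} = det M_{X,n}`,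
`b_0 = ∏_{k=1}^n k!`, `b_1 = d_n σ_X² ∏_{k=1}^n k!`, `b_{d_n} = det M_{X,n}`, such that for all
`t ≥ 0` the denominator is positive and `pmmse_n(X,t)` equals the quotient. -/
theorem pmmseAt_rational
    {Ω : Type*} [MeasurableSpace Ω] (P : Measure Ω) [IsProbabilityMeasure P]
    (X N : Ω → ℝ) (hXm : Measurable X) (hNm : Measurable N)
    (n : ℕ) (hn : 1 ≤ n)
    (hX2n : Integrable (fun ω => X ω ^ (2 * n)) P)
    (hN : Measure.map N P = gaussianReal 0 1)
    (hindep : IndepFun X N P) :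
    ∃ a b : ℕ → ℝ,
      a 0 = varRV P X * ∏ k ∈ Finset.Icc 1 n, (Nat.factorial k : ℝ) ∧
      a (n * (n + 1) / 2 - 1) = (hankelMoment P X n).det ∧
      b 0 = ∏ k ∈ Finset.Icc 1 n, (Nat.factorial k : ℝ) ∧
      b 1 = (n * (n + 1) / 2 : ℕ) * varRV P X * ∏ k ∈ Finset.Icc 1 n, (Nat.factorial k : ℝ) ∧
      b (n * (n + 1) / 2) = (hankelMoment P X n).det ∧
      ∀ t : ℝ, 0 ≤ t →
        0 < (∑ j ∈ Finset.range (n * (n + 1) / 2 + 1), b j * t ^ j) ∧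
        pmmseAt P X N n t =
          (∑ j ∈ Finset.range (n * (n + 1) / 2), a j * t ^ j) /
            (∑ j ∈ Finset.range (n * (n + 1) / 2 + 1), b j * t ^ j) := by
  set m : ℕ → ℝ := fun k => ∫ ω, X ω ^ k ∂P with hmdef
  set g : ℕ → ℝ := fun k => ∫ x : ℝ, x ^ k ∂gaussianReal 0 1 with hgdef
  have hm : m 0 = 1 := by simp [hmdef]
  have hg : IsGaussianMoments 0 1 g := isGaussianMoments_gaussianReal
  have hNg (k : ℕ) : ∫ ω, N ω ^ k ∂P = g k := by
    simp only [hgdef]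
    rw [← hN, integral_map hNm.aemeasurable (by fun_prop)]
  have hNint (k : ℕ) : Integrable (fun ω => N ω ^ k) P := by
    have h := integrable_pow_gaussianReal k
    rw [← hN] at h
    exact h.comp_measurable hNm
  have hXint {k : ℕ} (hk : k ≤ 2 * n) : Integrable (fun ω => X ω ^ k) P :=
    integrable_pow_of_le hXm hX2n hk
  have hvar : varRV P X = m 2 - m 1 ^ 2 := by simp [varRV, hmdef]
  have hdet : (hankelMoment P X n).det = (hankel m n).det := rfl
  have hd : 1 ≤ n * (n + 1) / 2 := by
    rw [Nat.le_div_iff_mul_le two_pos]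
    nlinarith
  refine ⟨fun j => (numerator m g n).coeff (2 * j),
    fun j => (hankel (channelMoment m g) n).det.coeff (2 * j), ?_, ?_, ?_, ?_, ?_, ?_⟩
  · rw [hvar]
    exact coeff_zero_numerator hm hg n
  · rw [hdet]
    exact (natDegree_numerator_le_and_coeff hm hg hn).2
  · exact coeff_zero_det_hankel_channelMoment hm hg n
  · rw [hvar]
    exact coeff_two_det_hankel_channelMoment hm hg n
  · rw [hdet]
    exact (natDegree_det_hankel_le_and_coeff hg n).2
  · intro t ht
    have hdenom := eval_eq_sum_coeff_even (det_hankel_channelMoment_comp_neg_X hg n)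
      (natDegree_det_hankel_le_and_coeff (m := m) hg n).1 (√t)
    have hnum := eval_eq_sum_coeff_even (numerator_comp_neg_X (m := m) hg n)
      (natDegree_numerator_le_and_coeff hm hg hn).1 (√t)
    rw [Real.sq_sqrt ht] at hdenom hnum
    rw [Nat.sub_add_cancel hd] at hnum
    rw [← hdenom, ← hnum]
    have hY (k : ℕ) (hk : k ≤ 2 * n) :=
      channel_moment hXm hNm hindep √t 0 k (fun j hj => hXint (by omega)) fun j _ => hNint j
    have hXY (k : ℕ) (hk : k ≤ n) :=
      channel_moment hXm hNm hindep √t 1 k (fun j hj => hXint (by omega)) fun j _ => hNint j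
    simp only [pow_zero, one_mul, zero_add, pow_one, hNg, add_comm 1] at hY hXY
    have hH : hankelMoment P (fun ω => √t * X ω + N ω) n =
        (hankel (channelMoment m g) n).map (Polynomial.evalRingHom √t) := by
      ext i j
      rw [hankelMoment, Matrix.of_apply, (hY _ (by omega)).2]
      exact (eval_channelMoment m g _ _).symm
    have hPD : (hankelMoment P (fun ω => √t * X ω + N ω) n).PosDef :=
      hankelMoment_posDef (fun k hk => (hY k hk).1)
        (fun S hS => measure_preimage_add_gaussian_eq_zero hXm hNm hindep hN √t hS)
        (IsProbabilityMeasure.ne_zero P)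
    have hdetH : (hankel (channelMoment m g) n).det.eval √t =
        (hankelMoment P (fun ω => √t * X ω + N ω) n).det := by
      rw [hH]
      exact RingHom.map_det (Polynomial.evalRingHom √t) _
    have hdetG : (numerator m g n).eval √t =
        (bordered (∫ ω, X ω ^ 2 ∂P)
          (fun j : Fin (n + 1) => ∫ ω, X ω * (√t * X ω + N ω) ^ (j : ℕ) ∂P)
          (hankelMoment P (fun ω => √t * X ω + N ω) n)).det := by
      rw [hH]
      refine (map_det_bordered (Polynomial.evalRingHom √t) _ _ _).trans ?_
      congr 2
      · simp [hmdef]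
      · ext1 j
        rw [(hXY j (by omega)).2]
        exact eval_channelMoment (fun i => m (i + 1)) g _ _
    rw [hdetG, hdetH, det_bordered_eq_pmmse_mul_det (hXint (by omega))
      (fun j hj => (hXY j hj).1) (fun k hk => (hY k hk).1) hPD]
    exact ⟨hPD.det_pos, (mul_div_cancel_right₀ _ hPD.det_pos.ne').symm⟩
end

section
/- For each integer k ≥ 1 there exists a finite constant η_k such that the following holds uniformly over all integrable real-valued random variables X: let N be a standard Gaussian random variable independent of X, let Y = X + N, and define f : ℝ → ℝ by f(y) := E[X · e^{−(X−y)²/2}] / E[e^{−(X−y)²/2}] (so f(Y) = E[X | Y] almost surely). Then f is k-times differentiable on ℝ and E[(f^{(k)}(Y))²] ≤ η_k². -/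
open MeasureTheory ProbabilityTheory

universe u

/-- The function `y ↦ E[X e^{-(X-y)²/2}] / E[e^{-(X-y)²/2}]`, which is a version of the
conditional expectation `E[X | X + N = y]` in a standard Gaussian channel. -/
noncomputable def condExpFn {Ω : Type*} [MeasurableSpace Ω] (P : Measure Ω)
    (X : Ω → ℝ) (y : ℝ) : ℝ :=
  (∫ ω, X ω * Real.exp (-(X ω - y) ^ 2 / 2) ∂P) /
    ∫ ω, Real.exp (-(X ω - y) ^ 2 / 2) ∂P

/-- The unnormalised Gaussian average `∫ g(x - y) e^{-(x-y)²/2} dμ(x)`. -/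
noncomputable def gaussWeighted (μ : Measure ℝ) (g : ℝ → ℝ) (y : ℝ) : ℝ :=
  ∫ x, g (x - y) * Real.exp (-(x - y) ^ 2 / 2) ∂μ

/-- The conditional average of `g (X - y)` given `X + N = y`, where `X` has law `μ`. -/
noncomputable def channelAvg (μ : Measure ℝ) (g : ℝ → ℝ) (y : ℝ) : ℝ :=
  gaussWeighted μ g y / gaussWeighted μ (fun _ => 1) y

/-- The `j`-th conditional moment of `X - y` given `X + N = y`, where `X` has law `μ`. -/
noncomputable def channelMoment (μ : Measure ℝ) (y : ℝ) (j : ℕ) : ℝ :=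
  channelAvg μ (fun t => t ^ j) y

/-- The derivation of the polynomial ring on the conditional moments induced by `d/dy`. -/
noncomputable def momentDerivation :
    Derivation ℝ (MvPolynomial ℕ ℝ) (MvPolynomial ℕ ℝ) :=
  MvPolynomial.mkDerivation ℝ fun j =>
    MvPolynomial.X (j + 1) - MvPolynomial.C (j : ℝ) * MvPolynomial.X (j - 1)
      - MvPolynomial.X j * MvPolynomial.X 1

/-- The polynomial in the conditional moments representing the `(k + 1)`-st derivative of the
conditional expectation. -/
noncomputable def derivPoly (k : ℕ) : MvPolynomial ℕ ℝ :=
  momentDerivation^[k] (1 + momentDerivation (MvPolynomial.X 1))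

lemma one_add_sq_pow_le (n : ℕ) (t : ℝ) :
    (1 + t ^ 2) ^ n ≤ (4 ^ n * n.factorial * Real.exp (1 / 4)) * Real.exp (t ^ 2 / 4) := by
  have h := Real.pow_div_factorial_le_exp ((1 + t ^ 2) / 4) (by positivity) n
  rw [div_le_iff₀ (by positivity), div_pow, div_le_iff₀ (by positivity)] at h
  calc (1 + t ^ 2) ^ n ≤ Real.exp ((1 + t ^ 2) / 4) * n.factorial * 4 ^ n := h
    _ = _ := by rw [add_div, Real.exp_add]; ring

lemma one_add_sq_pow_mul_exp_le (n : ℕ) (t : ℝ) :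
    (1 + t ^ 2) ^ n * Real.exp (-t ^ 2 / 2)
      ≤ (4 ^ n * n.factorial * Real.exp (1 / 4)) * Real.exp (-(1 / 4) * t ^ 2) := by
  refine (mul_le_mul_of_nonneg_right (one_add_sq_pow_le n t) (Real.exp_nonneg _)).trans_eq ?_
  rw [mul_assoc, ← Real.exp_add]
  congr 2
  ring

lemma abs_pow_le_one_add_sq_pow (j : ℕ) (t : ℝ) : |t ^ j| ≤ (1 + t ^ 2) ^ j := by
  rw [abs_pow]
  refine pow_le_pow_left₀ (abs_nonneg t) ?_ j
  nlinarith [sq_nonneg (|t| - 1), sq_abs t]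

lemma abs_mul_exp_le {g : ℝ → ℝ} {n : ℕ} (hb : ∀ t, |g t| ≤ (1 + t ^ 2) ^ n) (t : ℝ) :
    |g t * Real.exp (-t ^ 2 / 2)| ≤ 4 ^ n * n.factorial * Real.exp (1 / 4) := by
  rw [abs_mul, Real.abs_exp]
  calc |g t| * Real.exp (-t ^ 2 / 2)
      ≤ (1 + t ^ 2) ^ n * Real.exp (-t ^ 2 / 2) := by gcongr; exact hb t
    _ ≤ _ := one_add_sq_pow_mul_exp_le n t
    _ ≤ (4 ^ n * n.factorial * Real.exp (1 / 4)) * 1 := by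
        gcongr
        exact Real.exp_le_one_iff.2 (by nlinarith [sq_nonneg t])
    _ = _ := mul_one _

section

variable {μ : Measure ℝ} [IsProbabilityMeasure μ]

lemma integrable_mul_gauss {g : ℝ → ℝ} (hg : Measurable g) {n : ℕ}
    (hb : ∀ t, |g t| ≤ (1 + t ^ 2) ^ n) (y : ℝ) :
    Integrable (fun x => g (x - y) * Real.exp (-(x - y) ^ 2 / 2)) μ := by
  refine Integrable.of_bound (C := 4 ^ n * n.factorial * Real.exp (1 / 4)) ?_ ?_
  · exact Measurable.aestronglyMeasurable (by fun_prop)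
  · exact Filter.Eventually.of_forall fun x => abs_mul_exp_le hb (x - y)

lemma integrable_one_add_sq_pow_mul_gauss (n : ℕ) (y : ℝ) :
    Integrable (fun x => (1 + (x - y) ^ 2) ^ n * Real.exp (-(x - y) ^ 2 / 2)) μ :=
  integrable_mul_gauss (g := fun t => (1 + t ^ 2) ^ n) (by fun_prop)
    (fun t => (abs_of_nonneg (by positivity)).le) y

lemma integrable_pow_mul_gauss (j : ℕ) (y : ℝ) :
    Integrable (fun x => (x - y) ^ j * Real.exp (-(x - y) ^ 2 / 2)) μ :=
  integrable_mul_gauss (g := fun t => t ^ j) (by fun_prop) (abs_pow_le_one_add_sq_pow j) y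

lemma gaussWeighted_one_pos (y : ℝ) : 0 < gaussWeighted μ (fun _ => 1) y := by
  have h := integrable_pow_mul_gauss (μ := μ) 0 y
  simp only [pow_zero] at h
  unfold gaussWeighted
  rw [integral_pos_iff_support_of_nonneg (fun x => by positivity) h]
  have : (Function.support fun x => 1 * Real.exp (-(x - y) ^ 2 / 2)) = Set.univ := by
    ext x; simp [Real.exp_ne_zero]
  rw [this]
  simp

lemma hasDerivAt_gaussWeighted_pow (j : ℕ) (y : ℝ) :
    HasDerivAt (gaussWeighted μ (fun t => t ^ j))
      (gaussWeighted μ (fun t => t ^ (j + 1)) y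
        - j * gaussWeighted μ (fun t => t ^ (j - 1)) y) y := by
  have hF (x : ℝ) (z : ℝ) : HasDerivAt (fun z => (x - z) ^ j * Real.exp (-(x - z) ^ 2 / 2))
      ((x - z) ^ (j + 1) * Real.exp (-(x - z) ^ 2 / 2)
        - j * ((x - z) ^ (j - 1) * Real.exp (-(x - z) ^ 2 / 2))) z := by
    have h1 : HasDerivAt (fun z => x - z) (-1) z := by
      simpa using (hasDerivAt_id z).const_sub x
    have h2 : HasDerivAt (fun z => -(x - z) ^ 2 / 2) (x - z) z := by
      convert! ((h1.pow 2).neg.div_const 2) using 1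
      simp
    convert! (h1.pow j).mul h2.exp using 1
    simp only [Pi.pow_apply]
    ring
  have key := hasDerivAt_integral_of_dominated_loc_of_deriv_le (μ := μ) (s := Set.univ)
    (F := fun z x => (x - z) ^ j * Real.exp (-(x - z) ^ 2 / 2))
    (F' := fun z x => (x - z) ^ (j + 1) * Real.exp (-(x - z) ^ 2 / 2)
        - j * ((x - z) ^ (j - 1) * Real.exp (-(x - z) ^ 2 / 2))) (x₀ := y)
    (bound := fun _ => 4 ^ (j + 1) * (j + 1).factorial * Real.exp (1 / 4)
      + j * (4 ^ (j - 1) * (j - 1).factorial * Real.exp (1 / 4)))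
    Filter.univ_mem
    (Filter.Eventually.of_forall fun z => (integrable_pow_mul_gauss j z).aestronglyMeasurable)
    (integrable_pow_mul_gauss j y)
    ((integrable_pow_mul_gauss (j + 1) y).sub
      ((integrable_pow_mul_gauss (j - 1) y).const_mul _)).aestronglyMeasurable
    (Filter.Eventually.of_forall fun x z _ => ?_) (integrable_const _)
    (Filter.Eventually.of_forall fun x z _ => hF x z)
  · have h := key.2
    rw [integral_sub (integrable_pow_mul_gauss (j + 1) y)
      ((integrable_pow_mul_gauss (j - 1) y).const_mul _), integral_const_mul] at h
    exact h
  · refine (norm_sub_le _ _).trans (add_le_add ?_ ?_)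
    · exact abs_mul_exp_le (abs_pow_le_one_add_sq_pow (j + 1)) (x - z)
    · rw [norm_mul, Real.norm_natCast]
      gcongr
      exact abs_mul_exp_le (abs_pow_le_one_add_sq_pow (j - 1)) (x - z)

lemma hasDerivAt_channelMoment (j : ℕ) (y : ℝ) :
    HasDerivAt (fun y => channelMoment μ y j)
      (channelMoment μ y (j + 1) - j * channelMoment μ y (j - 1)
        - channelMoment μ y j * channelMoment μ y 1) y := by
  have hpos := gaussWeighted_one_pos (μ := μ) y
  have h0 := hasDerivAt_gaussWeighted_pow (μ := μ) 0 y
  simp only [pow_zero, zero_add, Nat.cast_zero, zero_mul, sub_zero] at h0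
  convert! (hasDerivAt_gaussWeighted_pow (μ := μ) j y).div h0 hpos.ne' using 1
  simp only [channelMoment, channelAvg]
  field_simp

lemma hasDerivAt_eval_channelMoment (p : MvPolynomial ℕ ℝ) (y : ℝ) :
    HasDerivAt (fun y => MvPolynomial.eval (channelMoment μ y) p)
      (MvPolynomial.eval (channelMoment μ y) (momentDerivation p)) y := by
  induction p using MvPolynomial.induction_on with
  | C a => simpa [momentDerivation] using hasDerivAt_const y a
  | add p q hp hq => simpa using! hp.add hq
  | mul_X p j hp =>
    have h := hp.mul (hasDerivAt_channelMoment (μ := μ) j y)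
    convert! h using 1
    · ext z; simp
    · simp [Derivation.leibniz, momentDerivation]
      ring

lemma channelAvg_one_add_sq_pow_nonneg (n : ℕ) (y : ℝ) :
    0 ≤ channelAvg μ (fun t => (1 + t ^ 2) ^ n) y :=
  div_nonneg (integral_nonneg fun x => by positivity) (gaussWeighted_one_pos y).le

lemma channelAvg_one_add_sq_pow_mul_le (a b : ℕ) (y : ℝ) :
    channelAvg μ (fun t => (1 + t ^ 2) ^ a) y * channelAvg μ (fun t => (1 + t ^ 2) ^ b) y
      ≤ channelAvg μ (fun t => (1 + t ^ 2) ^ (a + b)) y := by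
  rcases Nat.eq_zero_or_pos a with rfl | ha
  · simp [channelAvg, (gaussWeighted_one_pos (μ := μ) y).ne']
  have hpos := gaussWeighted_one_pos (μ := μ) y
  have hA := channelAvg_one_add_sq_pow_nonneg (μ := μ) a y
  set A := channelAvg μ (fun t => (1 + t ^ 2) ^ a) y with hAdef
  set c := A ^ (a⁻¹ : ℝ)
  have hc : 0 ≤ c := Real.rpow_nonneg hA _
  have hca : c ^ a = A := Real.rpow_inv_natCast_pow hA ha.ne'
  have hpt (x : ℝ) : c ^ b * ((1 + (x - y) ^ 2) ^ a * Real.exp (-(x - y) ^ 2 / 2))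
        + A * ((1 + (x - y) ^ 2) ^ b * Real.exp (-(x - y) ^ 2 / 2))
        - A * c ^ b * (1 * Real.exp (-(x - y) ^ 2 / 2))
      ≤ (1 + (x - y) ^ 2) ^ (a + b) * Real.exp (-(x - y) ^ 2 / 2) := by
    have h : 0 ≤ ((1 + (x - y) ^ 2) ^ a - c ^ a) * ((1 + (x - y) ^ 2) ^ b - c ^ b) := by
      rcases le_total c (1 + (x - y) ^ 2) with h | h
      · exact mul_nonneg (sub_nonneg.2 (by gcongr)) (sub_nonneg.2 (by gcongr))
      · exact mul_nonneg_of_nonpos_of_nonpos (sub_nonpos.2 (by gcongr)) (sub_nonpos.2 (by gcongr))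
    rw [hca] at h
    have := mul_nonneg h (Real.exp_nonneg (-(x - y) ^ 2 / 2))
    rw [pow_add]
    linarith
  have ia := (integrable_one_add_sq_pow_mul_gauss (μ := μ) a y).const_mul (c ^ b)
  have ib := (integrable_one_add_sq_pow_mul_gauss (μ := μ) b y).const_mul A
  have i0 := (integrable_pow_mul_gauss (μ := μ) 0 y).const_mul (A * c ^ b)
  simp only [pow_zero] at i0
  have h := integral_mono ((ia.add ib).sub i0)
    (integrable_one_add_sq_pow_mul_gauss (μ := μ) (a + b) y) hpt
  rw [integral_sub' (ia.add ib) i0, integral_add' ia ib, integral_const_mul, integral_const_mul,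
    integral_const_mul] at h
  change c ^ b * gaussWeighted μ (fun t => (1 + t ^ 2) ^ a) y
    + A * gaussWeighted μ (fun t => (1 + t ^ 2) ^ b) y - A * c ^ b * gaussWeighted μ (fun _ => 1) y
    ≤ gaussWeighted μ (fun t => (1 + t ^ 2) ^ (a + b)) y at h
  have hA' : gaussWeighted μ (fun t => (1 + t ^ 2) ^ a) y
      = A * gaussWeighted μ (fun _ => 1) y := by
    rw [hAdef, channelAvg, div_mul_cancel₀ _ hpos.ne']
  rw [hA'] at h
  rw [channelAvg, channelAvg, ← mul_div_assoc]
  refine div_le_div_of_nonneg_right ?_ hpos.le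
  linarith

lemma abs_channelMoment_le (j : ℕ) (y : ℝ) :
    |channelMoment μ y j| ≤ channelAvg μ (fun t => (1 + t ^ 2) ^ j) y := by
  have hpos := gaussWeighted_one_pos (μ := μ) y
  rw [channelMoment, channelAvg, channelAvg, abs_div, abs_of_pos hpos]
  refine div_le_div_of_nonneg_right ?_ hpos.le
  refine abs_integral_le_integral_abs.trans ?_
  refine integral_mono (integrable_pow_mul_gauss j y).abs
    (integrable_one_add_sq_pow_mul_gauss j y) fun x => ?_
  simp only [abs_mul, Real.abs_exp]
  gcongr
  exact abs_pow_le_one_add_sq_pow j _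

lemma channelAvg_one_add_sq_pow_mono {a b : ℕ} (hab : a ≤ b) (y : ℝ) :
    channelAvg μ (fun t => (1 + t ^ 2) ^ a) y ≤ channelAvg μ (fun t => (1 + t ^ 2) ^ b) y := by
  refine div_le_div_of_nonneg_right ?_ (gaussWeighted_one_pos y).le
  refine integral_mono (integrable_one_add_sq_pow_mul_gauss a y)
    (integrable_one_add_sq_pow_mul_gauss b y) fun x => ?_
  dsimp only
  gcongr
  nlinarith [sq_nonneg (x - y)]

end

lemma exists_abs_eval_channelMoment_le (p : MvPolynomial ℕ ℝ) :
    ∃ C : ℝ, 0 ≤ C ∧ ∃ n : ℕ, ∀ (μ : Measure ℝ) [IsProbabilityMeasure μ] (y : ℝ),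
      |MvPolynomial.eval (channelMoment μ y) p|
        ≤ C * channelAvg μ (fun t => (1 + t ^ 2) ^ n) y := by
  induction p using MvPolynomial.induction_on with
  | C a =>
    refine ⟨|a|, abs_nonneg a, 0, fun μ _ y => ?_⟩
    simp [channelAvg, (gaussWeighted_one_pos (μ := μ) y).ne']
  | add p q hp hq =>
    obtain ⟨C, hC, n, hp⟩ := hp
    obtain ⟨D, hD, m, hq⟩ := hq
    refine ⟨C + D, by positivity, max n m, fun μ _ y => ?_⟩
    rw [map_add, add_mul]
    refine (abs_add_le _ _).trans (add_le_add ((hp μ y).trans ?_) ((hq μ y).trans ?_))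
    · gcongr
      exact channelAvg_one_add_sq_pow_mono (le_max_left n m) y
    · gcongr
      exact channelAvg_one_add_sq_pow_mono (le_max_right n m) y
  | mul_X p j hp =>
    obtain ⟨C, hC, n, hp⟩ := hp
    refine ⟨C, hC, n + j, fun μ _ y => ?_⟩
    rw [map_mul, abs_mul, MvPolynomial.eval_X]
    have hn := channelAvg_one_add_sq_pow_nonneg (μ := μ) n y
    calc _ ≤ (C * channelAvg μ (fun t => (1 + t ^ 2) ^ n) y)
          * channelAvg μ (fun t => (1 + t ^ 2) ^ j) y :=
        mul_le_mul (hp μ y) (abs_channelMoment_le j y) (abs_nonneg _) (by positivity)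
      _ ≤ _ := by
        rw [mul_assoc]
        gcongr
        exact channelAvg_one_add_sq_pow_mul_le n j y

lemma condExpFn_eq {Ω : Type*} [MeasurableSpace Ω] (P : Measure Ω) [IsProbabilityMeasure P]
    {X : Ω → ℝ} (hX : Measurable X) (y : ℝ) :
    condExpFn P X y = y + channelMoment (P.map X) y 1 := by
  have := Measure.isProbabilityMeasure_map (μ := P) hX.aemeasurable
  have hpos := gaussWeighted_one_pos (μ := P.map X) y
  have i0 := (integrable_pow_mul_gauss (μ := P.map X) 0 y).const_mul y
  have i1 := integrable_pow_mul_gauss (μ := P.map X) 1 y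
  simp only [pow_zero] at i0
  have hden : ∫ ω, Real.exp (-(X ω - y) ^ 2 / 2) ∂P = gaussWeighted (P.map X) (fun _ => 1) y := by
    rw [gaussWeighted, integral_map hX.aemeasurable
      (Measurable.aestronglyMeasurable (by fun_prop))]
    simp
  have hnum : ∫ ω, X ω * Real.exp (-(X ω - y) ^ 2 / 2) ∂P
      = y * gaussWeighted (P.map X) (fun _ => 1) y
        + gaussWeighted (P.map X) (fun t => t ^ 1) y := by
    rw [gaussWeighted, gaussWeighted, ← integral_const_mul, ← integral_add i0 i1,
      integral_map hX.aemeasurable (Measurable.aestronglyMeasurable (by fun_prop))]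
    congr 1
    ext ω
    ring
  rw [condExpFn, hnum, hden, channelMoment, channelAvg]
  field_simp

lemma iteratedDeriv_succ_condExpFn {Ω : Type*} [MeasurableSpace Ω] (P : Measure Ω)
    [IsProbabilityMeasure P] {X : Ω → ℝ} (hX : Measurable X) (k : ℕ) :
    iteratedDeriv (k + 1) (condExpFn P X)
      = fun y => MvPolynomial.eval (channelMoment (P.map X) y) (derivPoly k) := by
  have := Measure.isProbabilityMeasure_map (μ := P) hX.aemeasurable
  induction k with
  | zero =>
    ext y
    rw [zero_add, iteratedDeriv_one, funext (condExpFn_eq P hX)]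
    have h := (hasDerivAt_id y).add
      (hasDerivAt_eval_channelMoment (μ := P.map X) (MvPolynomial.X 1) y)
    simp only [MvPolynomial.eval_X] at h
    simpa [derivPoly] using! h.deriv
  | succ k ih =>
    ext y
    rw [iteratedDeriv_succ, ih, (hasDerivAt_eval_channelMoment (derivPoly k) y).deriv]
    simp only [derivPoly, Function.iterate_succ_apply']

lemma differentiable_iteratedDeriv_condExpFn {Ω : Type*} [MeasurableSpace Ω] (P : Measure Ω)
    [IsProbabilityMeasure P] {X : Ω → ℝ} (hX : Measurable X) (j : ℕ) :
    Differentiable ℝ (iteratedDeriv j (condExpFn P X)) := by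
  have := Measure.isProbabilityMeasure_map (μ := P) hX.aemeasurable
  cases j with
  | zero =>
    rw [iteratedDeriv_zero, funext (condExpFn_eq P hX)]
    exact differentiable_id.add fun y => (hasDerivAt_channelMoment 1 y).differentiableAt
  | succ k =>
    rw [iteratedDeriv_succ_condExpFn P hX k]
    exact fun y => (hasDerivAt_eval_channelMoment _ y).differentiableAt

lemma gaussianPDF_zero_one (t : ℝ) :
    gaussianPDF 0 1 t = ENNReal.ofReal ((√(2 * Real.pi))⁻¹ * Real.exp (-t ^ 2 / 2)) := by
  simp [gaussianPDF, gaussianPDFReal]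

lemma lintegral_one_add_sq_pow_gaussianReal_lt_top (n : ℕ) :
    ∫⁻ t, ENNReal.ofReal ((1 + t ^ 2) ^ n) ∂(gaussianReal 0 1) < ⊤ := by
  rw [gaussianReal_of_var_ne_zero 0 one_ne_zero, lintegral_withDensity_eq_lintegral_mul _
    (measurable_gaussianPDF 0 1) (by fun_prop)]
  have hint : Integrable fun t : ℝ => (√(2 * Real.pi))⁻¹ *
      ((4 ^ n * n.factorial * Real.exp (1 / 4)) * Real.exp (-(1 / 4) * t ^ 2)) :=
    ((integrable_exp_neg_mul_sq (by norm_num)).const_mul _).const_mul _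
  refine lt_of_le_of_lt (lintegral_mono fun t => ?_) hint.lintegral_lt_top
  rw [Pi.mul_apply, gaussianPDF_zero_one, ← ENNReal.ofReal_mul (by positivity)]
  refine ENNReal.ofReal_le_ofReal ?_
  rw [mul_right_comm, mul_assoc]
  exact mul_le_mul_of_nonneg_left (one_add_sq_pow_mul_exp_le n t) (by positivity)

lemma measurable_gaussWeighted (μ : Measure ℝ) [IsProbabilityMeasure μ] {g : ℝ → ℝ}
    (hg : Measurable g) : Measurable (gaussWeighted μ g) := by
  refine (StronglyMeasurable.integral_prod_left (μ := μ)
    (f := fun x y => g (x - y) * Real.exp (-(x - y) ^ 2 / 2)) ?_).measurable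
  exact Measurable.stronglyMeasurable (by unfold Function.uncurry; fun_prop)

lemma measurable_channelAvg (μ : Measure ℝ) [IsProbabilityMeasure μ] {g : ℝ → ℝ}
    (hg : Measurable g) : Measurable (channelAvg μ g) :=
  (measurable_gaussWeighted μ hg).div (measurable_gaussWeighted μ measurable_const)

lemma lintegral_channelAvg_one_add_sq_pow (μ : Measure ℝ) [IsProbabilityMeasure μ] (n : ℕ) :
    ∫⁻ x, ∫⁻ z, ENNReal.ofReal (channelAvg μ (fun t => (1 + t ^ 2) ^ n) (x + z))
        ∂(gaussianReal 0 1) ∂μ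
      = ∫⁻ t, ENNReal.ofReal ((1 + t ^ 2) ^ n) ∂(gaussianReal 0 1) := by
  set g : ℝ → ℝ := fun t => (1 + t ^ 2) ^ n with hg
  have hgm : Measurable g := by fun_prop
  have hF := measurable_channelAvg μ hgm
  have hpdf : Measurable (gaussianPDF 0 1) := measurable_gaussianPDF 0 1
  have hdens (f : ℝ → ENNReal) (hf : Measurable f) :
      ∫⁻ z, f z ∂(gaussianReal 0 1) = ∫⁻ z, gaussianPDF 0 1 z * f z := by
    rw [gaussianReal_of_var_ne_zero 0 one_ne_zero,
      lintegral_withDensity_eq_lintegral_mul _ hpdf hf]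
    rfl
  have hjoint (h : ℝ → ℝ) (hm : Measurable h) (hh : ∀ t, 0 ≤ h t) (y : ℝ)
      (hi : Integrable (fun x => h (x - y) * Real.exp (-(x - y) ^ 2 / 2)) μ) :
      ∫⁻ x, gaussianPDF 0 1 (x - y) * ENNReal.ofReal (h (x - y)) ∂μ
        = ENNReal.ofReal ((√(2 * Real.pi))⁻¹ * gaussWeighted μ h y) := by
    rw [gaussWeighted, ← integral_const_mul, ofReal_integral_eq_lintegral_ofReal (hi.const_mul _)
      (Filter.Eventually.of_forall fun x => by have := hh (x - y); positivity)]
    refine lintegral_congr fun x => ?_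
    rw [gaussianPDF_zero_one, ← ENNReal.ofReal_mul (by positivity)]
    congr 1
    ring
  calc ∫⁻ x, ∫⁻ z, ENNReal.ofReal (channelAvg μ g (x + z)) ∂(gaussianReal 0 1) ∂μ
      = ∫⁻ x, ∫⁻ y, gaussianPDF 0 1 (x - y) * ENNReal.ofReal (channelAvg μ g y) ∂volume ∂μ := by
        refine lintegral_congr fun x => ?_
        rw [hdens _ (by fun_prop), ← lintegral_sub_right_eq_self _ x]
        refine lintegral_congr fun y => ?_
        rw [add_sub_cancel, gaussianPDF_zero_one, gaussianPDF_zero_one, ← neg_sub x y, neg_sq]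
    _ = ∫⁻ y, ∫⁻ x, gaussianPDF 0 1 (x - y) * ENNReal.ofReal (channelAvg μ g y) ∂μ ∂volume :=
        lintegral_lintegral_swap (Measurable.aemeasurable
          (by unfold Function.uncurry; fun_prop))
    _ = ∫⁻ y, ∫⁻ x, gaussianPDF 0 1 (x - y) * ENNReal.ofReal (g (x - y)) ∂μ ∂volume := by
        refine lintegral_congr fun y => ?_
        have hpos := gaussWeighted_one_pos (μ := μ) y
        have h1 := hjoint (fun _ => 1) measurable_const (fun _ => zero_le_one) y
          (by simpa using integrable_pow_mul_gauss (μ := μ) 0 y)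
        simp only [ENNReal.ofReal_one, mul_one] at h1
        rw [lintegral_mul_const _ (by fun_prop), h1, hjoint g hgm (fun t => by positivity) y
          (integrable_one_add_sq_pow_mul_gauss n y), ← ENNReal.ofReal_mul (by positivity),
          channelAvg]
        congr 1
        field_simp
    _ = ∫⁻ x, ∫⁻ y, gaussianPDF 0 1 (x - y) * ENNReal.ofReal (g (x - y)) ∂volume ∂μ :=
        (lintegral_lintegral_swap (Measurable.aemeasurable
          (by unfold Function.uncurry; fun_prop))).symm
    _ = ∫⁻ t, ENNReal.ofReal (g t) ∂(gaussianReal 0 1) := by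
        rw [hdens _ (by fun_prop)]
        simp_rw [lintegral_sub_left_eq_self
          (fun t => gaussianPDF 0 1 t * ENNReal.ofReal (g t))]
        simp

/-- For each `k ≥ 1` there is a finite constant `η_k` such that, uniformly
over all integrable real random variables `X` (with `N` a standard Gaussian independent of
`X`, `Y = X + N`, and `f` the conditional-expectation function above), `f` is `k`-times
differentiable and `E[(f^{(k)}(Y))²] ≤ η_k²`. -/
theorem uniform_bound_condexp_derivative (k : ℕ) (hk : 1 ≤ k) :
    ∃ η : ℝ, ∀ (Ω : Type u) [MeasurableSpace Ω] (P : Measure Ω)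
      [IsProbabilityMeasure P] (X N : Ω → ℝ),
      Measurable X → Measurable N → Integrable X P →
      Measure.map N P = gaussianReal 0 1 → IndepFun X N P →
      (∀ j < k, Differentiable ℝ (iteratedDeriv j (condExpFn P X))) ∧
        (∫ ω, (iteratedDeriv k (condExpFn P X) (X ω + N ω)) ^ 2 ∂P) ≤ η ^ 2 := by
  obtain ⟨k, rfl⟩ : ∃ m, k = m + 1 := ⟨k - 1, by omega⟩
  obtain ⟨C, hC, n, hbound⟩ := exists_abs_eval_channelMoment_le (derivPoly k ^ 2)
  set K := ∫⁻ t, ENNReal.ofReal ((1 + t ^ 2) ^ n) ∂(gaussianReal 0 1)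
  refine ⟨√(C * K.toReal), fun Ω _ P _ X N hX hN _ hNlaw hindep =>
    ⟨fun j _ => differentiable_iteratedDeriv_condExpFn P hX j, ?_⟩⟩
  rw [Real.sq_sqrt (by positivity)]
  have := Measure.isProbabilityMeasure_map (μ := P) hX.aemeasurable
  have hmeas := measurable_channelAvg (P.map X)
    (g := fun t => (1 + t ^ 2) ^ n) (by fun_prop)
  have hlaw := (indepFun_iff_map_prod_eq_prod_map_map hX.aemeasurable hN.aemeasurable).1 hindep
  rw [hNlaw] at hlaw
  have hle : ∫⁻ ω, ‖(iteratedDeriv (k + 1) (condExpFn P X) (X ω + N ω)) ^ 2‖ₑ ∂P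
      ≤ ENNReal.ofReal C * K := by
    calc _ ≤ ∫⁻ ω, ENNReal.ofReal C * ENNReal.ofReal
            (channelAvg (P.map X) (fun t => (1 + t ^ 2) ^ n) (X ω + N ω)) ∂P := by
          refine lintegral_mono fun ω => ?_
          rw [← ENNReal.ofReal_mul hC, Real.enorm_eq_ofReal_abs,
            iteratedDeriv_succ_condExpFn P hX k]
          refine ENNReal.ofReal_le_ofReal ?_
          have := hbound (P.map X) (X ω + N ω)
          rwa [map_pow] at this
      _ = ENNReal.ofReal C * ∫⁻ p : ℝ × ℝ, ENNReal.ofReal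
            (channelAvg (P.map X) (fun t => (1 + t ^ 2) ^ n) (p.1 + p.2))
            ∂((P.map X).prod (gaussianReal 0 1)) := by
          rw [lintegral_const_mul _ (by fun_prop), ← hlaw,
            lintegral_map (by fun_prop) (hX.prodMk hN)]
      _ = ENNReal.ofReal C * K := by
          rw [lintegral_prod _ (by fun_prop), lintegral_channelAvg_one_add_sq_pow]
  have hfin : ENNReal.ofReal C * K ≠ ⊤ :=
    ENNReal.mul_ne_top ENNReal.ofReal_ne_top
      (lintegral_one_add_sq_pow_gaussianReal_lt_top n).ne
  have h := ENNReal.toReal_mono hfin ((enorm_integral_le_lintegral_enorm _).trans hle)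
  rw [toReal_enorm, ENNReal.toReal_mul, ENNReal.toReal_ofReal hC] at h
  exact (Real.le_norm_self _).trans h
end
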